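/- Let I ⊆ P = P(d,m) be a color-squarefree monomial ideal and set I' = I + 𝔪_1^{[2]} + ⋯ + 𝔪_d^{[2]} ⊆ P' = P(d, m+(1,…,1)). Then the ℤ^{d+|m|}-graded Betti numbers of P'/(I' + Σ_{i=1}^d x_{i,m_i+1}·𝔪_i) over P' are given by β_{k,a}(P'/(I' + Σ_{i=1}^d x_{i,m_i+1}·𝔪_i)) = Σ_{j=0}^d Σ_{u ∈ [Mon_cs(P)]_j} β_{k−j, a − deg(u·∏_{i ∈ cSupp(u)} x_{i,m_i+1})}(P'/(I' : u)). -/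

import Mathlib

open Finset
open scoped Classical

noncomputable section

namespace BalSq

variable {d : ℕ} {m : Fin d → ℕ}

/-- The set of variables `x_{i,j}` of `P(d,m)`: the variable `⟨i,j⟩` has color `i`. -/
abbrev Var (d : ℕ) (m : Fin d → ℕ) : Type := Σ i : Fin d, Fin (m i)

/-- Monomials of `P(d,m)`, encoded as exponent vectors. -/
abbrev Mon (d : ℕ) (m : Fin d → ℕ) : Type := Var d m →₀ ℕ

/-- The vertex set `V = V_1 ∪ ⋯ ∪ V_d`, where `V_i` has `m i + 1` elements;
these are also the variables of `P(d, m + (1,…,1))`. -/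
abbrev Vtx (d : ℕ) (m : Fin d → ℕ) : Type := Σ i : Fin d, Fin (m i + 1)

/-- The monomial `x_{i,j}`. -/
def xvar (i : Fin d) (j : Fin (m i)) : Mon d m := Finsupp.single ⟨i, j⟩ 1

/-- Total degree of a monomial. -/
def deg (u : Mon d m) : ℕ := u.sum fun _ n => n

/-- A monomial is color-squarefree if it is divisible by at most one variable of each color. -/
def ColorSquarefree (u : Mon d m) : Prop :=
  ∀ i : Fin d, (∑ j : Fin (m i), u ⟨i, j⟩) ≤ 1

/-- A color-squarefree monomial order ideal: a finite set of color-squarefree monomials,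
closed under divisibility, containing `1` and all the variables. -/
def IsOrderIdeal (U : Finset (Mon d m)) : Prop :=
  (∀ u ∈ U, ColorSquarefree u) ∧
  (∀ u ∈ U, ∀ v : Mon d m, v ≤ u → v ∈ U) ∧
  ((0 : Mon d m) ∈ U) ∧
  (∀ (i : Fin d) (j : Fin (m i)), xvar i j ∈ U)

/-- The strict order `≺` on variables: `x_{i,j} ≺ x_{k,ℓ}` iff `i < k`, or `i = k` and `j < ℓ`. -/
def vlt (a b : Var d m) : Prop :=
  a.1 < b.1 ∨ (a.1 = b.1 ∧ (a.2 : ℕ) < (b.2 : ℕ))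

variable (K : Type*) [Field K]

/-- The polynomial ring `P(d,m)`. -/
abbrev PR (d : ℕ) (m : Fin d → ℕ) (K : Type*) [Field K] : Type _ :=
  MvPolynomial (Var d m) K

/-- The monomial of `P(d,m)` with exponent vector `u`. -/
def mon (u : Mon d m) : PR d m K := MvPolynomial.monomial u 1

/-- The ideal `I(U)` generated by all monomials of `P(d,m)` not lying in `U`. -/
def IU (U : Finset (Mon d m)) : Ideal (PR d m K) :=
  Ideal.span { p : PR d m K | ∃ u : Mon d m, u ∉ U ∧ p = mon K u }

/-- The ideal `𝔪_1^2 + ⋯ + 𝔪_d^2` of `P(d,m)`. -/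
def sqIdeal : Ideal (PR d m K) :=
  Ideal.span { p : PR d m K | ∃ (i : Fin d) (j k : Fin (m i)),
    p = mon K (xvar i j + xvar i k) }

/-- A monomial ideal is strongly color-stable if `x_{k,ℓ}·u ∈ I` and `j < ℓ` imply
`x_{k,j}·u ∈ I`. -/
def StronglyColorStable (I : Ideal (PR d m K)) : Prop :=
  ∀ (u : Mon d m) (k : Fin d) (l j : Fin (m k)),
    mon K (xvar k l + u) ∈ I → j < l → mon K (xvar k j + u) ∈ I

/-- Strongly color-stable across colors. -/
def StronglyColorStableAcross (I : Ideal (PR d m K)) : Prop :=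
  StronglyColorStable K I ∧
  ∀ (u : Mon d m) (k : Fin d) (l : Fin (m k)) (i : Fin d) (j : Fin (m i)),
    ColorSquarefree (xvar k l + u) → mon K (xvar k l + u) ∈ I →
    vlt ⟨i, j⟩ ⟨k, l⟩ → ColorSquarefree (xvar i j + u) → mon K (xvar i j + u) ∈ I

/-- The minimal monomial generators of a monomial ideal. -/
def MinGens (I : Ideal (PR d m K)) : Set (Mon d m) :=
  { w | mon K w ∈ I ∧ ∀ v : Mon d m, v ≤ w → v ≠ w → mon K v ∉ I }

/-- The embedding of the variables of `P(d,m)` into those of `P(d, m + (1,…,1))`,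
identifying the vertex `j^{(i)}` with the variable `x_{i,j}`. -/
def emb : Var d m → Vtx d m := fun v => ⟨v.1, v.2.castSucc⟩

/-- The polynomial ring `P(d, m + (1,…,1))`. -/
abbrev Pp (d : ℕ) (m : Fin d → ℕ) (K : Type*) [Field K] : Type _ :=
  MvPolynomial (Vtx d m) K

/-- The Stanley-Reisner ideal of a simplicial complex on the vertex set `V`,
generated by the squarefree monomials corresponding to non-faces. -/
def SRIdeal (Δ : Set (Finset (Vtx d m))) : Ideal (Pp d m K) :=
  Ideal.span { p : Pp d m K | ∃ F : Finset (Vtx d m), F ∉ Δ ∧ p = ∏ v ∈ F, MvPolynomial.X v }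

/-- A finite set of variables is color-squarefree if it contains at most one variable of each
color; such sets correspond to the color-squarefree monomials of `P(d,m)`. -/
def CSFSet (A : Finset (Var d m)) : Prop :=
  ∀ v ∈ A, ∀ w ∈ A, v.1 = w.1 → v = w

/-- The color-squarefree monomial of `P(d, m + (1,…,1))` corresponding to `A`. -/
def monA (A : Finset (Var d m)) : Pp d m K :=
  MvPolynomial.monomial (∑ v ∈ A, Finsupp.single (emb v) 1) 1

/-- The ideal `𝔪_1^{[2]} + ⋯ + 𝔪_d^{[2]}` of `P(d, m + (1,…,1))`. -/
def brIdeal : Ideal (Pp d m K) :=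
  Ideal.span { p : Pp d m K | ∃ (i : Fin d) (j k : Fin (m i)), j < k ∧
    p = MvPolynomial.X (⟨i, j.castSucc⟩ : Vtx d m) * MvPolynomial.X (⟨i, k.castSucc⟩ : Vtx d m) }

/-- The ideal `Σ_{i=1}^d x_{i,m_i+1}·𝔪_i` of `P(d, m + (1,…,1))`. -/
def lastIdeal : Ideal (Pp d m K) :=
  Ideal.span { p : Pp d m K | ∃ (i : Fin d) (j : Fin (m i)),
    p = MvPolynomial.X (⟨i, Fin.last (m i)⟩ : Vtx d m) *
        MvPolynomial.X (⟨i, j.castSucc⟩ : Vtx d m) }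

/-- The degree of `u·∏_{i ∈ cSupp u} x_{i,m_i+1}`, for the color-squarefree monomial `u`
with support `A`. -/
def shiftDeg (A : Finset (Var d m)) : Vtx d m →₀ ℕ :=
  ∑ v ∈ A, (Finsupp.single (emb v) 1 +
    Finsupp.single (⟨v.1, Fin.last (m v.1)⟩ : Vtx d m) 1)

/-- The colon ideal `(I : u)`, where `u` is the color-squarefree monomial with support `A`. -/
def colonOf (I : Ideal (Pp d m K)) (A : Finset (Var d m)) : Ideal (Pp d m K) :=
  Submodule.colon (I : Submodule (Pp d m K) (Pp d m K)) (Ideal.span {monA K A})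

/-- The index set `[Mon_cs(P)]_k` of color-squarefree monomials of degree `k`, encoded by
their supports. -/
abbrev CSFk (d : ℕ) (m : Fin d → ℕ) (k : ℕ) : Type _ :=
  {A : Finset (Var d m) // CSFSet A ∧ A.card = k}

/-- The module `F_k = ⊕_{u ∈ [Mon_cs(P)]_k} P'/(I : u)`. -/
abbrev FmodC (I : Ideal (Pp d m K)) (k : ℕ) : Type _ :=
  ∀ A : CSFk d m k, Pp d m K ⧸ colonOf K I A.1

/-- A `P'`-linear map `P'/N₁ → P'/N₂` is graded of degree `0` with respect to the shifts
`s₁`, `s₂` (source shifted by `-s₁`, target by `-s₂`) iff it is induced by multiplication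
with a homogeneous polynomial of degree `s₁ - s₂`. -/
def GradedBetween (N₁ N₂ : Ideal (Pp d m K)) (s₁ s₂ : Vtx d m →₀ ℕ)
    (g : (Pp d m K ⧸ N₁) →ₗ[Pp d m K] Pp d m K ⧸ N₂) : Prop :=
  ∃ p : Pp d m K, (∀ μ : Vtx d m →₀ ℕ, MvPolynomial.coeff μ p ≠ 0 → μ + s₂ = s₁) ∧
    ∀ x : Pp d m K, g (Submodule.Quotient.mk x) = Submodule.Quotient.mk (p * x)

/-- The component of a linear map between direct sums (products). -/
def piComp {R : Type*} [CommRing R] {ι₁ ι₂ : Type*} [DecidableEq ι₁]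
    {M₁ : ι₁ → Type*} {M₂ : ι₂ → Type*}
    [∀ i, AddCommGroup (M₁ i)] [∀ i, Module R (M₁ i)]
    [∀ i, AddCommGroup (M₂ i)] [∀ i, Module R (M₂ i)]
    (f : (∀ i, M₁ i) →ₗ[R] ∀ i, M₂ i) (a : ι₁) (b : ι₂) : M₁ a →ₗ[R] M₂ b :=
  (LinearMap.proj b) ∘ₗ f ∘ₗ (LinearMap.single R M₁ a)

/-- The extension of the ideal `I ⊆ P(d,m)` to `P(d, m + (1,…,1))`, plus
`𝔪_1^{[2]} + ⋯ + 𝔪_d^{[2]}`; this is the ideal `I'`. -/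
def extBr (I : Ideal (PR d m K)) : Ideal (Pp d m K) :=
  Ideal.map (MvPolynomial.rename (emb : Var d m → Vtx d m)) I ⊔ brIdeal K

/-- The free module over `MvPolynomial σ K` with, for each degree `a : D`, exactly `β a`
generators in degree `a` (i.e. `⊕_a (MvPolynomial σ K)(-a)^{β a}`). -/
abbrev FMod (σ : Type*) (K : Type*) [Field K] {D : Type*} (β : D → ℕ) : Type _ :=
  (Σ a : D, Fin (β a)) →₀ MvPolynomial σ K

/-- `β : ℕ → D → ℕ` is the table of `D`-graded Betti numbers of `R/I`, where the grading on
`R = MvPolynomial σ K` is induced by the degree map `δ` on exponent vectors: there is a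
graded minimal free resolution `⋯ → F_1 → F_0 → R → R/I → 0` with
`F_k = ⊕_a R(-a)^{β k a}`.  Minimality means that all entries of the differentials lie in the
maximal ideal generated by the variables. -/
def IsMinFreeRes (σ : Type*) (K : Type*) [Field K] {D : Type*} [AddCommMonoid D]
    (δ : (σ →₀ ℕ) → D) (I : Ideal (MvPolynomial σ K)) (β : ℕ → D → ℕ) : Prop :=
  ∃ (dm : ∀ k : ℕ, FMod σ K (β (k + 1)) →ₗ[MvPolynomial σ K] FMod σ K (β k))
    (ε : FMod σ K (β 0) →ₗ[MvPolynomial σ K] MvPolynomial σ K),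
    (∀ (a : D) (i : Fin (β 0 a)) (μ : σ →₀ ℕ),
        MvPolynomial.coeff μ (ε (Finsupp.single ⟨a, i⟩ 1)) ≠ 0 → δ μ = a) ∧
    (∀ (k : ℕ) (a : D) (i : Fin (β (k + 1) a)) (b : D) (j : Fin (β k b)) (μ : σ →₀ ℕ),
        MvPolynomial.coeff μ ((dm k (Finsupp.single ⟨a, i⟩ 1)) ⟨b, j⟩) ≠ 0 → δ μ + b = a) ∧
    (∀ (k : ℕ) (a : D) (i : Fin (β (k + 1) a)) (b : D) (j : Fin (β k b)),
        MvPolynomial.coeff 0 ((dm k (Finsupp.single ⟨a, i⟩ 1)) ⟨b, j⟩) = 0) ∧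
    (LinearMap.range ε ⊔ (I : Submodule (MvPolynomial σ K) (MvPolynomial σ K)) = ⊤) ∧
    (LinearMap.range (dm 0)
      = Submodule.comap ε (I : Submodule (MvPolynomial σ K) (MvPolynomial σ K))) ∧
    (∀ k : ℕ, LinearMap.range (dm (k + 1)) = LinearMap.ker (dm k))

section Aux

set_option linter.unusedSectionVars false
set_option linter.style.haveILetI false

section Generic
variable {k : Type*} [Field k] {D : Type*} [PartialOrder D]

/-- span of the generators of degree at most `a`. -/
def Lv (k : Type*) [Field k] {ι : Type} (dg : ι → D) (a : D) : Submodule k (ι →₀ k) :=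
  Finsupp.supported k k {i | dg i ≤ a}

/-- span of the generators of degree strictly below `a`. -/
def Ls (k : Type*) [Field k] {ι : Type} (dg : ι → D) (a : D) : Submodule k (ι →₀ k) :=
  Finsupp.supported k k {i | dg i < a}

theorem map_mem_of {ι : Type} {M : Type*} [AddCommGroup M] [Module k M]
    (φ : (ι →₀ k) →ₗ[k] M) (S : Submodule k M) (s : Set ι)
    (h : ∀ i ∈ s, φ (Finsupp.single i 1) ∈ S) {v : ι →₀ k}
    (hv : v ∈ Finsupp.supported k k s) : φ v ∈ S := by
  rw [Finsupp.supported_eq_span_single] at hv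
  induction hv using Submodule.span_induction with
  | mem x hx => obtain ⟨i, hi, rfl⟩ := hx; exact h i hi
  | zero => simp
  | add x y _ _ hx hy => rw [map_add]; exact S.add_mem hx hy
  | smul c x _ hx => rw [map_smul]; exact S.smul_mem _ hx

theorem eq_on_of {ι : Type} {M : Type*} [AddCommGroup M] [Module k M]
    (φ ψ : (ι →₀ k) →ₗ[k] M) (s : Set ι)
    (h : ∀ i ∈ s, φ (Finsupp.single i 1) = ψ (Finsupp.single i 1)) {v : ι →₀ k}
    (hv : v ∈ Finsupp.supported k k s) : φ v = ψ v := by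
  have := map_mem_of (φ - ψ) ⊥ s (by intro i hi; simp [h i hi]) hv
  simpa [sub_eq_zero] using this

theorem Lv_mono {ι : Type} (dg : ι → D) {a b : D} (h : a ≤ b) : Lv k dg a ≤ Lv k dg b :=
  Finsupp.supported_mono fun _ hi => le_trans hi h

theorem Ls_mono {ι : Type} (dg : ι → D) {a b : D} (h : a ≤ b) : Ls k dg a ≤ Ls k dg b :=
  Finsupp.supported_mono fun _ hi => lt_of_lt_of_le hi h

theorem Lv_le_Ls {ι : Type} (dg : ι → D) {a b : D} (h : a < b) : Lv k dg a ≤ Ls k dg b :=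
  Finsupp.supported_mono fun _ hi => lt_of_le_of_lt hi h

theorem Ls_le_Lv {ι : Type} (dg : ι → D) {a : D} : Ls k dg a ≤ Lv k dg a :=
  Finsupp.supported_mono fun _ hi => le_of_lt hi

theorem single_mem_Lv {ι : Type} (dg : ι → D) (i : ι) :
    Finsupp.single i (1:k) ∈ Lv k dg (dg i) :=
  Finsupp.single_mem_supported k _ (le_refl (dg i))

/-- A filtered map. -/
def Filt {ι κ : Type} (di : ι → D) (dk : κ → D) (φ : (ι →₀ k) →ₗ[k] (κ →₀ k)) : Prop :=
  ∀ i, φ (Finsupp.single i 1) ∈ Lv k dk (di i)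

/-- A strictly filtered map. -/
def SFilt {ι κ : Type} (di : ι → D) (dk : κ → D) (φ : (ι →₀ k) →ₗ[k] (κ →₀ k)) : Prop :=
  ∀ i, φ (Finsupp.single i 1) ∈ Ls k dk (di i)

section
variable {ι κ : Type} {di : ι → D} {dk : κ → D} {φ : (ι →₀ k) →ₗ[k] (κ →₀ k)}

theorem Filt.lv (h : Filt di dk φ) {a : D} {v} (hv : v ∈ Lv k di a) : φ v ∈ Lv k dk a :=
  map_mem_of φ _ _ (fun i hi => Lv_mono dk hi (h i)) hv

theorem Filt.ls (h : Filt di dk φ) {a : D} {v} (hv : v ∈ Ls k di a) : φ v ∈ Ls k dk a :=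
  map_mem_of φ _ _ (fun i hi => Lv_le_Ls dk hi (h i)) hv

theorem SFilt.ls (h : SFilt di dk φ) {a : D} {v} (hv : v ∈ Lv k di a) : φ v ∈ Ls k dk a :=
  map_mem_of φ _ _ (fun i hi => Ls_mono dk hi (h i)) hv

theorem SFilt.filt (h : SFilt di dk φ) : Filt di dk φ := fun i => Ls_le_Lv dk (h i)
end

/-- A minimal multigraded resolution, in dehomogenized form, of the module which is `k` in the
degrees satisfying `Q`. -/
structure FRes (k : Type*) [Field k] {D : Type*} [PartialOrder D] (Q : D → Prop) where
  ι : ℕ → Type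
  dg : ∀ n, ι n → D
  fin : ∀ n a, Finite {i : ι n // dg n i = a}
  d : ∀ n, (ι (n + 1) →₀ k) →ₗ[k] (ι n →₀ k)
  ε : (ι 0 →₀ k) →ₗ[k] k
  filt : ∀ n, SFilt (dg (n + 1)) (dg n) (d n)
  eps : ∀ i, ε (Finsupp.single i 1) ≠ 0 → Q (dg 0 i)
  surj : ∀ a, Q a → ∃ v ∈ Lv k (dg 0) a, ε v = 1
  ex0 : ∀ a, ∀ v ∈ Lv k (dg 0) a, (Q a → ε v = 0) → ∃ w ∈ Lv k (dg 1) a, d 0 w = v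
  comp0 : ∀ a, ∀ w ∈ Lv k (dg 1) a, Q a → ε (d 0 w) = 0
  comp : ∀ n v, d n (d (n + 1) v) = 0
  ex : ∀ n a, ∀ v ∈ Lv k (dg (n + 1)) a, d n v = 0 → ∃ w ∈ Lv k (dg (n + 2)) a, d (n + 1) w = v

/-- Betti numbers. -/
def FRes.betti {Q : D → Prop} (F : FRes k Q) (n : ℕ) (a : D) : ℕ :=
  Nat.card {i : F.ι n // F.dg n i = a}

/-- linear extension -/
def lext {ι : Type} {M : Type*} [AddCommGroup M] [Module k M] (g : ι → M) : (ι →₀ k) →ₗ[k] M :=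
  Finsupp.linearCombination k g

@[simp] theorem lext_single {ι : Type} {M : Type*} [AddCommGroup M] [Module k M] (g : ι → M)
    (i : ι) : lext (k := k) g (Finsupp.single i 1) = g i := by simp [lext]

section Comparison
variable {Q1 Q2 : D → Prop} (F : FRes k Q1) (G : FRes k Q2)

/-- the comparison map -/
def cmp : ∀ n, (F.ι n →₀ k) →ₗ[k] (G.ι n →₀ k)
  | 0 => lext fun i =>
      if h : ∃ w ∈ Lv k (G.dg 0) (F.dg 0 i), G.ε w = F.ε (Finsupp.single i 1)
      then h.choose else 0
  | n + 1 => lext fun i =>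
      if h : ∃ w ∈ Lv k (G.dg (n + 1)) (F.dg (n + 1) i),
        G.d n w = cmp n (F.d n (Finsupp.single i 1))
      then h.choose else 0

theorem cmp_succ_single (n : ℕ) (i) : cmp F G (n + 1) (Finsupp.single i 1) =
      if h : ∃ w ∈ Lv k (G.dg (n + 1)) (F.dg (n + 1) i),
        G.d n w = cmp F G n (F.d n (Finsupp.single i 1))
      then h.choose else 0 := by rw [cmp, lext_single]

theorem cmp_filt (n : ℕ) : Filt (F.dg n) (G.dg n) (cmp F G n) := by
  intro i
  cases n with
  | zero =>
    rw [cmp, lext_single]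
    split_ifs with h
    · exact h.choose_spec.1
    · exact Submodule.zero_mem _
  | succ n =>
    rw [cmp, lext_single]
    split_ifs with h
    · exact h.choose_spec.1
    · exact Submodule.zero_mem _

/-- compatibility of the two degree sets -/
def Compat (Q1 Q2 : D → Prop) : Prop := ∀ a b, a ≤ b → Q1 a → Q2 b → Q2 a ∧ Q1 b

theorem cmp_eps (H : Compat Q1 Q2) {b : D} (hb : Q2 b) {v} (hv : v ∈ Lv k (F.dg 0) b) :
    G.ε (cmp F G 0 v) = F.ε v := by
  refine eq_on_of (G.ε ∘ₗ cmp F G 0) F.ε _ ?_ hv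
  intro i hi
  have hex : ∃ w ∈ Lv k (G.dg 0) (F.dg 0 i), G.ε w = F.ε (Finsupp.single i 1) := by
    by_cases h : F.ε (Finsupp.single i 1) = 0
    · exact ⟨0, Submodule.zero_mem _, by simp [h]⟩
    · obtain ⟨w, hw, hw1⟩ := G.surj _ (H _ _ hi (F.eps i h) hb).1
      exact ⟨F.ε (Finsupp.single i 1) • w, Submodule.smul_mem _ _ hw, by simp [hw1]⟩
  rw [LinearMap.comp_apply, cmp, lext_single, dif_pos hex]
  exact hex.choose_spec.2

theorem eps_zero (H : Compat Q1 Q2) {b : D} (hb : Q2 b) (hb1 : ¬ Q1 b) {v}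
    (hv : v ∈ Lv k (F.dg 0) b) : F.ε v = 0 := by
  refine eq_on_of F.ε 0 _ ?_ hv
  intro i hi
  by_contra h
  exact hb1 (H _ _ hi (F.eps i h) hb).2

theorem cmp_comm (H : Compat Q1 Q2) (n : ℕ) (v) :
    G.d n (cmp F G (n + 1) v) = cmp F G n (F.d n v) := by
  have key : G.d n ∘ₗ cmp F G (n + 1) = cmp F G n ∘ₗ F.d n := by
    clear v
    induction n with
    | zero =>
      refine Finsupp.lhom_ext' fun i => LinearMap.ext_ring ?_
      have hex : ∃ w ∈ Lv k (G.dg (0 + 1)) (F.dg (0 + 1) i),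
          G.d 0 w = cmp F G 0 (F.d 0 (Finsupp.single i 1)) := by
        have h1 : F.d 0 (Finsupp.single i 1) ∈ Lv k (F.dg 0) (F.dg 1 i) :=
          (F.filt 0).filt i
        refine G.ex0 _ _ ((cmp_filt F G 0).lv h1) ?_
        intro hQ
        rw [cmp_eps F G H hQ h1]
        by_cases h2 : Q1 (F.dg 1 i)
        · exact F.comp0 _ _ (single_mem_Lv _ i) h2
        · exact eps_zero F H hQ h2 h1
      simp only [LinearMap.comp_apply, Finsupp.lsingle_apply]
      rw [cmp_succ_single, dif_pos hex]
      exact hex.choose_spec.2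
    | succ n ih =>
      refine Finsupp.lhom_ext' fun i => LinearMap.ext_ring ?_
      have hex : ∃ w ∈ Lv k (G.dg (n + 1 + 1)) (F.dg (n + 1 + 1) i),
          G.d (n + 1) w = cmp F G (n + 1) (F.d (n + 1) (Finsupp.single i 1)) := by
        have h1 := (F.filt (n + 1)).filt i
        refine G.ex _ _ _ ((cmp_filt F G _).lv h1) ?_
        rw [← LinearMap.comp_apply, ih, LinearMap.comp_apply, F.comp, map_zero]
      simp only [LinearMap.comp_apply, Finsupp.lsingle_apply]
      rw [cmp_succ_single, dif_pos hex]
      exact hex.choose_spec.2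
  exact LinearMap.congr_fun key v

end Comparison

section Homotopy
variable {Q : D → Prop} (F G : FRes k Q) (φ : ∀ n, (F.ι n →₀ k) →ₗ[k] (G.ι n →₀ k))

/-- the null homotopy -/
def hty : ∀ n, (F.ι n →₀ k) →ₗ[k] (G.ι (n + 1) →₀ k)
  | 0 => lext fun i =>
      if h : ∃ w ∈ Lv k (G.dg 1) (F.dg 0 i), G.d 0 w = φ 0 (Finsupp.single i 1)
      then h.choose else 0
  | n + 1 => lext fun i =>
      if h : ∃ w ∈ Lv k (G.dg (n + 2)) (F.dg (n + 1) i),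
        G.d (n + 1) w = φ (n + 1) (Finsupp.single i 1) - hty n (F.d n (Finsupp.single i 1))
      then h.choose else 0

theorem hty_succ_single (n : ℕ) (i) : hty F G φ (n + 1) (Finsupp.single i 1) =
      if h : ∃ w ∈ Lv k (G.dg (n + 2)) (F.dg (n + 1) i),
        G.d (n + 1) w = φ (n + 1) (Finsupp.single i 1) - hty F G φ n (F.d n (Finsupp.single i 1))
      then h.choose else 0 := by rw [hty, lext_single]

theorem hty_filt (n : ℕ) : Filt (F.dg n) (G.dg (n + 1)) (hty F G φ n) := by
  intro i
  cases n with
  | zero =>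
    rw [hty, lext_single]
    split_ifs with h
    · exact h.choose_spec.1
    · exact Submodule.zero_mem _
  | succ n =>
    rw [hty, lext_single]
    split_ifs with h
    · exact h.choose_spec.1
    · exact Submodule.zero_mem _

theorem hty_zero
    (hφ : ∀ n, Filt (F.dg n) (G.dg n) (φ n))
    (he : ∀ b, Q b → ∀ v ∈ Lv k (F.dg 0) b, G.ε (φ 0 v) = 0)
    (v) : G.d 0 (hty F G φ 0 v) = φ 0 v := by
  have key : G.d 0 ∘ₗ hty F G φ 0 = φ 0 := by
    refine Finsupp.lhom_ext' fun i => LinearMap.ext_ring ?_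
    have hex : ∃ w ∈ Lv k (G.dg 1) (F.dg 0 i), G.d 0 w = φ 0 (Finsupp.single i 1) :=
      G.ex0 _ _ (hφ 0 i) fun hQ => he _ hQ _ (single_mem_Lv _ i)
    simp only [LinearMap.comp_apply, Finsupp.lsingle_apply]
    rw [hty, lext_single, dif_pos hex]
    exact hex.choose_spec.2
  exact LinearMap.congr_fun key v


theorem hty_succ
    (hφ : ∀ n, Filt (F.dg n) (G.dg n) (φ n))
    (hc : ∀ n v, G.d n (φ (n + 1) v) = φ n (F.d n v))
    (he : ∀ b, Q b → ∀ v ∈ Lv k (F.dg 0) b, G.ε (φ 0 v) = 0)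
    (n : ℕ) (v) :
    G.d (n + 1) (hty F G φ (n + 1) v) = φ (n + 1) v - hty F G φ n (F.d n v) := by
  have key : G.d (n + 1) ∘ₗ hty F G φ (n + 1) = φ (n + 1) - hty F G φ n ∘ₗ F.d n := by
    clear v
    induction n with
    | zero =>
      refine Finsupp.lhom_ext' fun i => LinearMap.ext_ring ?_
      have hex : ∃ w ∈ Lv k (G.dg (0 + 2)) (F.dg (0 + 1) i), G.d (0 + 1) w =
          φ (0 + 1) (Finsupp.single i 1) - hty F G φ 0 (F.d 0 (Finsupp.single i 1)) := by
        refine G.ex _ _ _ (Submodule.sub_mem _ (hφ _ i)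
          ((hty_filt F G φ 0).lv ((F.filt 0).filt i))) ?_
        rw [map_sub, hty_zero F G φ hφ he, hc, sub_self]
      simp only [LinearMap.comp_apply, Finsupp.lsingle_apply, LinearMap.sub_apply]
      rw [hty_succ_single, dif_pos hex]
      exact hex.choose_spec.2
    | succ n ih =>
      refine Finsupp.lhom_ext' fun i => LinearMap.ext_ring ?_
      have hex : ∃ w ∈ Lv k (G.dg (n + 1 + 2)) (F.dg (n + 1 + 1) i), G.d (n + 1 + 1) w =
          φ (n + 1 + 1) (Finsupp.single i 1)
            - hty F G φ (n + 1) (F.d (n + 1) (Finsupp.single i 1)) := by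
        refine G.ex _ _ _ (Submodule.sub_mem _ (hφ _ i)
          ((hty_filt F G φ (n + 1)).lv ((F.filt (n + 1)).filt i))) ?_
        have := LinearMap.congr_fun ih (F.d (n + 1) (Finsupp.single i 1))
        simp only [LinearMap.comp_apply, LinearMap.sub_apply] at this
        rw [map_sub, this, hc, F.comp, map_zero, sub_zero, sub_self]
      simp only [LinearMap.comp_apply, Finsupp.lsingle_apply, LinearMap.sub_apply]
      rw [hty_succ_single, dif_pos hex]
      exact hex.choose_spec.2
  exact LinearMap.congr_fun key v


theorem null_strict
    (hφ : ∀ n, Filt (F.dg n) (G.dg n) (φ n))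
    (hc : ∀ n v, G.d n (φ (n + 1) v) = φ n (F.d n v))
    (he : ∀ b, Q b → ∀ v ∈ Lv k (F.dg 0) b, G.ε (φ 0 v) = 0)
    (n : ℕ) : SFilt (F.dg n) (G.dg n) (φ n) := by
  intro i
  cases n with
  | zero =>
    rw [← hty_zero F G φ hφ he]
    exact (G.filt 0).ls (hty_filt F G φ 0 i)
  | succ n =>
    have h := hty_succ F G φ hφ hc he n (Finsupp.single i 1)
    rw [eq_sub_iff_add_eq] at h
    rw [← h]
    exact Submodule.add_mem _ ((G.filt (n + 1)).ls (hty_filt F G φ (n + 1) i))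
      ((hty_filt F G φ n).ls (F.filt n i))

end Homotopy

section Unique

/-- inclusion of degree-`a` part -/
def inc {ι : Type} (dg : ι → D) (a : D) : ({i : ι // dg i = a} →₀ k) →ₗ[k] (ι →₀ k) :=
  Finsupp.lmapDomain k k Subtype.val

/-- restriction to degree-`a` part -/
def res {ι : Type} (dg : ι → D) (a : D) : (ι →₀ k) →ₗ[k] ({i : ι // dg i = a} →₀ k) :=
  Finsupp.lsubtypeDomain {i | dg i = a}

theorem res_apply {ι : Type} (dg : ι → D) (a : D) (v : ι →₀ k) (i) :
    res dg a v i = v i.1 := rfl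

theorem res_inc {ι : Type} (dg : ι → D) (a : D) (v) : res (k := k) dg a (inc dg a v) = v := by
  ext i
  rw [res_apply]
  exact Finsupp.mapDomain_apply Subtype.val_injective _ _

theorem inc_mem {ι : Type} (dg : ι → D) (a : D) (v) : inc (k := k) dg a v ∈ Lv k dg a := by
  refine map_mem_of (k := k) (ι := {i : ι // dg i = a}) (inc dg a) (Lv k dg a) Set.univ ?_ (by simp)
  intro i _
  simp only [inc, Finsupp.lmapDomain_apply, Finsupp.mapDomain_single]
  exact Finsupp.single_mem_supported k _ (le_of_eq i.2)

theorem res_Ls {ι : Type} (dg : ι → D) (a : D) {v} (hv : v ∈ Ls k dg a) : res dg a v = 0 := by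
  ext i
  rw [res_apply]
  by_contra h
  have := (Finsupp.mem_supported' k v).1 hv i.1 (by simp [i.2])
  exact h (by simpa using this)

theorem sub_inc_res {ι : Type} (dg : ι → D) (a : D) {v} (hv : v ∈ Lv k dg a) :
    v - inc dg a (res dg a v) ∈ Ls k dg a := by
  refine (Finsupp.mem_supported' k _).2 ?_
  intro i hi
  by_cases h : dg i = a
  · have : inc dg a (res dg a v) i = v i := by
      rw [← res_apply dg a (inc dg a (res dg a v)) ⟨i, h⟩, res_inc, res_apply]
    simp [this]
  · have h1 : ¬ dg i ≤ a := fun h2 => hi (lt_of_le_of_ne h2 h)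
    have h2 := (Finsupp.mem_supported' k v).1 hv i h1
    have h3 := (Finsupp.mem_supported' k _).1 (inc_mem dg a (res dg a v)) i h1
    simp [h2, h3]

theorem betti_le {Q : D → Prop} (F G : FRes k Q) (n : ℕ) (a : D) : F.betti n a ≤ G.betti n a := by
  have H : Compat Q Q := fun a b _ h1 h2 => ⟨h1, h2⟩
  let φ : ∀ n, (F.ι n →₀ k) →ₗ[k] (F.ι n →₀ k) :=
    fun n => cmp G F n ∘ₗ cmp F G n - LinearMap.id
  have hs : SFilt (F.dg n) (F.dg n) (φ n) := by
    refine null_strict F F φ ?_ ?_ ?_ n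
    · intro n i
      exact Submodule.sub_mem _ ((cmp_filt G F n).lv (cmp_filt F G n i)) (single_mem_Lv _ i)
    · intro n v
      simp only [φ, LinearMap.sub_apply, LinearMap.comp_apply, LinearMap.id_apply, map_sub]
      rw [cmp_comm G F H, cmp_comm F G H]
    · intro b hb v hv
      simp only [φ, LinearMap.sub_apply, LinearMap.comp_apply, LinearMap.id_apply, map_sub]
      rw [cmp_eps G F H hb ((cmp_filt F G 0).lv hv), cmp_eps F G H hb hv, sub_self]
  have := F.fin n a
  have := G.fin n a
  let f : ({i : F.ι n // F.dg n i = a} →₀ k) →ₗ[k] ({i : G.ι n // G.dg n i = a} →₀ k) :=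
    res (G.dg n) a ∘ₗ cmp F G n ∘ₗ inc (F.dg n) a
  let g : ({i : G.ι n // G.dg n i = a} →₀ k) →ₗ[k] ({i : F.ι n // F.dg n i = a} →₀ k) :=
    res (F.dg n) a ∘ₗ cmp G F n ∘ₗ inc (G.dg n) a
  have hgf : ∀ v, g (f v) = v := by
    intro v
    simp only [f, g, LinearMap.comp_apply]
    have h1 := inc_mem (F.dg n) a v
    set u := inc (F.dg n) a v with hu
    have h2 := (cmp_filt F G n).lv h1
    have h3 := res_Ls _ _ ((cmp_filt G F n).ls (sub_inc_res _ _ h2))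
    rw [map_sub, map_sub, sub_eq_zero] at h3
    rw [← h3]
    have h4 := res_Ls _ _ (hs.ls h1)
    simp only [φ, LinearMap.sub_apply, LinearMap.comp_apply, LinearMap.id_apply, map_sub,
      sub_eq_zero] at h4
    rw [h4, hu, res_inc]
  have hinj : Function.Injective f := Function.LeftInverse.injective hgf
  let _ := Fintype.ofFinite {i : F.ι n // F.dg n i = a}
  let _ := Fintype.ofFinite {i : G.ι n // G.dg n i = a}
  have := LinearMap.finrank_le_finrank_of_injective hinj
  rw [Module.finrank_finsupp_self, Module.finrank_finsupp_self] at this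
  simpa [FRes.betti, Nat.card_eq_fintype_card] using this

end Unique

end Generic

section Cone
variable {k : Type*} [Field k] {D : Type*} [PartialOrder D]

/-- first component -/
def sfst {α β : Type} : (α ⊕ β →₀ k) →ₗ[k] (α →₀ k) :=
  LinearMap.fst k _ _ ∘ₗ (Finsupp.sumFinsuppLEquivProdFinsupp k).toLinearMap

/-- second component -/
def ssnd {α β : Type} : (α ⊕ β →₀ k) →ₗ[k] (β →₀ k) :=
  LinearMap.snd k _ _ ∘ₗ (Finsupp.sumFinsuppLEquivProdFinsupp k).toLinearMap

/-- pairing -/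
def spair {α β : Type} : (α →₀ k) × (β →₀ k) →ₗ[k] (α ⊕ β →₀ k) :=
  (Finsupp.sumFinsuppLEquivProdFinsupp k).symm.toLinearMap

theorem sfst_apply {α β : Type} (u : α ⊕ β →₀ k) (x) : sfst u x = u (Sum.inl x) := rfl
theorem ssnd_apply {α β : Type} (u : α ⊕ β →₀ k) (x) : ssnd u x = u (Sum.inr x) := rfl
theorem sfst_spair {α β : Type} (p : (α →₀ k) × (β →₀ k)) : sfst (spair p) = p.1 := by
  simp [sfst, spair]
theorem ssnd_spair {α β : Type} (p : (α →₀ k) × (β →₀ k)) : ssnd (spair p) = p.2 := by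
  simp [ssnd, spair]
theorem spair_eta {α β : Type} (u : α ⊕ β →₀ k) : spair (sfst u, ssnd u) = u := by
  simp [spair, sfst, ssnd]
theorem sum_ext {α β : Type} {u v : α ⊕ β →₀ k} (h1 : sfst u = sfst v) (h2 : ssnd u = ssnd v) :
    u = v := by
  rw [← spair_eta u, h1, h2, spair_eta]

theorem sfst_inl {α β : Type} (i : α) :
    sfst (Finsupp.single (Sum.inl i : α ⊕ β) (1 : k)) = Finsupp.single i 1 := by
  ext x; simp [sfst_apply, Finsupp.single_apply]
theorem sfst_inr {α β : Type} (i : β) :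
    sfst (Finsupp.single (Sum.inr i : α ⊕ β) (1 : k)) = 0 := by
  ext x; simp [sfst_apply, Finsupp.single_apply]
theorem ssnd_inl {α β : Type} (i : α) :
    ssnd (Finsupp.single (Sum.inl i : α ⊕ β) (1 : k)) = 0 := by
  ext x; simp [ssnd_apply, Finsupp.single_apply]
theorem ssnd_inr {α β : Type} (i : β) :
    ssnd (Finsupp.single (Sum.inr i : α ⊕ β) (1 : k)) = Finsupp.single i 1 := by
  ext x; simp [ssnd_apply, Finsupp.single_apply]

theorem mem_supported_sum {α β : Type} (s : Set (α ⊕ β)) (u : α ⊕ β →₀ k) :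
    u ∈ Finsupp.supported k k s ↔ sfst u ∈ Finsupp.supported k k (Sum.inl ⁻¹' s) ∧
      ssnd u ∈ Finsupp.supported k k (Sum.inr ⁻¹' s) := by
  simp only [Finsupp.mem_supported', sfst_apply, ssnd_apply, Set.mem_preimage]
  constructor
  · intro h
    exact ⟨fun x hx => h _ hx, fun x hx => h _ hx⟩
  · rintro ⟨h1, h2⟩ (x | x) hx
    · exact h1 x hx
    · exact h2 x hx

theorem mem_Lv_sum {α β : Type} (p : α → D) (q : β → D) (a : D) (u : α ⊕ β →₀ k) :
    u ∈ Lv k (Sum.elim p q) a ↔ sfst u ∈ Lv k p a ∧ ssnd u ∈ Lv k q a :=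
  mem_supported_sum _ u

theorem mem_Ls_sum {α β : Type} (p : α → D) (q : β → D) (a : D) (u : α ⊕ β →₀ k) :
    u ∈ Ls k (Sum.elim p q) a ↔ sfst u ∈ Ls k p a ∧ ssnd u ∈ Ls k q a :=
  mem_supported_sum _ u

variable {Q Q1 : D → Prop} (F : FRes k Q) (G : FRes k Q1)

/-- cone index types -/
def cι : ℕ → Type
  | 0 => F.ι 0
  | n + 1 => F.ι (n + 1) ⊕ G.ι n

/-- cone degrees -/
def cdg : ∀ n, cι F G n → D
  | 0 => F.dg 0
  | n + 1 => Sum.elim (F.dg (n + 1)) (G.dg n)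

/-- cone differential, bottom -/
def c0 (f : ∀ n, (G.ι n →₀ k) →ₗ[k] (F.ι n →₀ k)) :
    (F.ι 1 ⊕ G.ι 0 →₀ k) →ₗ[k] (F.ι 0 →₀ k) := F.d 0 ∘ₗ sfst + f 0 ∘ₗ ssnd

/-- cone differential, higher -/
def cs (f : ∀ n, (G.ι n →₀ k) →ₗ[k] (F.ι n →₀ k)) (n : ℕ) :
    (F.ι (n + 2) ⊕ G.ι (n + 1) →₀ k) →ₗ[k] (F.ι (n + 1) ⊕ G.ι n →₀ k) :=
  spair ∘ₗ (LinearMap.prod (F.d (n + 1) ∘ₗ sfst + f (n + 1) ∘ₗ ssnd) (- (G.d n ∘ₗ ssnd)))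

/-- cone differential -/
def cd (f : ∀ n, (G.ι n →₀ k) →ₗ[k] (F.ι n →₀ k)) :
    ∀ n, (cι F G (n + 1) →₀ k) →ₗ[k] (cι F G n →₀ k)
  | 0 => c0 F G f
  | n + 1 => cs F G f n

theorem cd_zero (f : ∀ n, (G.ι n →₀ k) →ₗ[k] (F.ι n →₀ k)) (u : F.ι 1 ⊕ G.ι 0 →₀ k) :
    c0 F G f u = F.d 0 (sfst u) + f 0 (ssnd u) := rfl

theorem cd_succ_fst (f : ∀ n, (G.ι n →₀ k) →ₗ[k] (F.ι n →₀ k)) (n : ℕ)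
    (u : F.ι (n + 2) ⊕ G.ι (n + 1) →₀ k) :
    sfst (cs F G f n u) = F.d (n + 1) (sfst u) + f (n + 1) (ssnd u) :=
  sfst_spair _

theorem cd_succ_snd (f : ∀ n, (G.ι n →₀ k) →ₗ[k] (F.ι n →₀ k)) (n : ℕ)
    (u : F.ι (n + 2) ⊕ G.ι (n + 1) →₀ k) :
    ssnd (cs F G f n u) = - G.d n (ssnd u) :=
  ssnd_spair _

theorem fin_sum {α β : Type} (p : α → D) (q : β → D) (a : D)
    (h1 : Finite {i // p i = a}) (h2 : Finite {i // q i = a}) :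
    Finite {i : α ⊕ β // Sum.elim p q i = a} ∧
    Nat.card {i : α ⊕ β // Sum.elim p q i = a}
      = Nat.card {i // p i = a} + Nat.card {i // q i = a} := by
  have e : {i : α ⊕ β // Sum.elim p q i = a} ≃ {i // p i = a} ⊕ {i // q i = a} :=
    Equiv.subtypeSum
  exact ⟨Finite.of_equiv _ e.symm, by rw [Nat.card_congr e, Nat.card_sum]⟩

/-- The mapping cone. -/
def cone (f : ∀ n, (G.ι n →₀ k) →ₗ[k] (F.ι n →₀ k))
    (hf : ∀ n, SFilt (G.dg n) (F.dg n) (f n))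
    (hc : ∀ n v, F.d n (f (n + 1) v) = f n (G.d n v))
    (he : ∀ b, Q b → ∀ v ∈ Lv k (G.dg 0) b, F.ε (f 0 v) = G.ε v)
    (hQ : ∀ a, Q1 a → Q a) (hH : ∀ a b, a ≤ b → Q1 a → Q b → Q1 b) :
    FRes k (fun a => Q a ∧ ¬ Q1 a) := by
  have H : Compat Q1 Q := fun a b h h1 h2 => ⟨hQ _ h1, hH a b h h1 h2⟩
  let ε' : (F.ι 0 →₀ k) →ₗ[k] k := lext fun i =>
    if Q (F.dg 0 i) ∧ ¬ Q1 (F.dg 0 i) then F.ε (Finsupp.single i 1) else 0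
  have hε : ∀ a, Q a ∧ ¬ Q1 a → ∀ v ∈ Lv k (F.dg 0) a, ε' v = F.ε v := by
    intro a ha v hv
    refine eq_on_of ε' F.ε _ ?_ hv
    intro i hi
    simp only [ε', lext_single]
    split_ifs with h
    · rfl
    · by_contra h2
      have h3 := F.eps i (Ne.symm h2)
      exact h ⟨h3, fun h4 => ha.2 (hH _ _ hi h4 ha.1)⟩
  have exaux : ∀ n a (u : F.ι (n + 1) ⊕ G.ι n →₀ k),
      u ∈ Lv k (Sum.elim (F.dg (n + 1)) (G.dg n)) a →
      F.d n (sfst u) + f n (ssnd u) = 0 →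
      (∃ v ∈ Lv k (G.dg (n + 1)) a, G.d n v = ssnd u) →
      ∃ w ∈ Lv k (Sum.elim (F.dg (n + 2)) (G.dg (n + 1))) a, cs F G f n w = u := by
    rintro n a u hu h0 ⟨v, hv, hv1⟩
    rw [mem_Lv_sum] at hu
    obtain ⟨w, hw, hw1⟩ := F.ex n a (sfst u + f (n + 1) v)
      (Submodule.add_mem _ hu.1 ((hf _).filt.lv hv)) (by rw [map_add, hc, hv1, h0])
    refine ⟨spair (w, -v), ?_, ?_⟩
    · refine (mem_Lv_sum _ _ _ _).2 ?_
      rw [sfst_spair, ssnd_spair]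
      exact ⟨hw, Submodule.neg_mem _ hv⟩
    · refine sum_ext ?_ ?_
      · rw [cd_succ_fst, sfst_spair, ssnd_spair]
        simp [hw1]
      · rw [cd_succ_snd, ssnd_spair]
        simp [hv1]
  have filt0 : SFilt (Sum.elim (F.dg 1) (G.dg 0)) (F.dg 0) (c0 F G f) := by
    rintro (i | i)
    · rw [cd_zero, sfst_inl, ssnd_inl, map_zero, add_zero]; exact F.filt 0 i
    · rw [cd_zero, sfst_inr, ssnd_inr, map_zero, zero_add]; exact hf 0 i
  have filts : ∀ n, SFilt (Sum.elim (F.dg (n + 2)) (G.dg (n + 1)))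
      (Sum.elim (F.dg (n + 1)) (G.dg n)) (cs F G f n) := by
    rintro n (i | i)
    · refine (mem_Ls_sum _ _ _ _).2 ?_
      rw [cd_succ_fst, cd_succ_snd]
      rw [sfst_inl, ssnd_inl, map_zero, add_zero, map_zero, neg_zero]
      exact ⟨F.filt (n + 1) i, Submodule.zero_mem _⟩
    · refine (mem_Ls_sum _ _ _ _).2 ?_
      rw [cd_succ_fst, cd_succ_snd]
      rw [sfst_inr, ssnd_inr, map_zero, zero_add]
      exact ⟨hf (n + 1) i, Submodule.neg_mem _ (G.filt n i)⟩
  have heps : ∀ i, ε' (Finsupp.single i 1) ≠ 0 → Q (F.dg 0 i) ∧ ¬ Q1 (F.dg 0 i) := by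
    intro i h
    by_contra h2
    exact h (by simp only [ε']; rw [lext_single, if_neg h2])
  have hsurj : ∀ a, Q a ∧ ¬ Q1 a → ∃ v ∈ Lv k (F.dg 0) a, ε' v = 1 := by
    intro a ha
    obtain ⟨v, hv, h1⟩ := F.surj a ha.1
    exact ⟨v, hv, by rw [hε a ha v hv, h1]⟩
  have hex0 : ∀ a, ∀ v ∈ Lv k (F.dg 0) a, (Q a ∧ ¬ Q1 a → ε' v = 0) →
      ∃ w ∈ Lv k (Sum.elim (F.dg 1) (G.dg 0)) a, c0 F G f w = v := by
    intro a v hv h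
    by_cases h1 : Q1 a
    · obtain ⟨w, hw, hw1⟩ := G.surj a h1
      have hw' : F.ε v • w ∈ Lv k (G.dg 0) a := Submodule.smul_mem _ _ hw
      obtain ⟨u, hu, hu1⟩ := F.ex0 a (v - f 0 (F.ε v • w))
        (Submodule.sub_mem _ hv ((hf 0).filt.lv hw')) (by
          intro hq
          rw [map_sub, he a hq _ hw', map_smul, hw1]; simp)
      refine ⟨spair (u, F.ε v • w), (mem_Lv_sum _ _ _ _).2 ?_, ?_⟩
      · rw [sfst_spair, ssnd_spair]; exact ⟨hu, hw'⟩
      · rw [cd_zero, sfst_spair, ssnd_spair, hu1]; simp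
    · obtain ⟨u, hu, hu1⟩ := F.ex0 a v hv (by
        intro hq
        rw [← hε a ⟨hq, h1⟩ v hv]; exact h ⟨hq, h1⟩)
      refine ⟨spair (u, 0), (mem_Lv_sum _ _ _ _).2 ?_, ?_⟩
      · rw [sfst_spair, ssnd_spair]; exact ⟨hu, Submodule.zero_mem _⟩
      · rw [cd_zero, sfst_spair, ssnd_spair, hu1]; simp
  have hcomp0 : ∀ a, ∀ w ∈ Lv k (Sum.elim (F.dg 1) (G.dg 0)) a, Q a ∧ ¬ Q1 a →
      ε' (c0 F G f w) = 0 := by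
    intro a w hw ha
    have hw2 := (mem_Lv_sum _ _ _ _).1 hw
    rw [cd_zero]
    have h1 := (F.filt 0).filt.lv hw2.1
    have h2 := (hf 0).filt.lv hw2.2
    rw [hε a ha _ (Submodule.add_mem _ h1 h2), map_add, F.comp0 a _ hw2.1 ha.1,
      he a ha.1 _ hw2.2, eps_zero G H ha.1 ha.2 hw2.2, add_zero]
  have hcompz : ∀ v, c0 F G f (cs F G f 0 v) = 0 := by
    intro v
    rw [cd_zero, cd_succ_fst, cd_succ_snd, map_add, F.comp, hc]; simp
  have hcomps : ∀ n v, cs F G f n (cs F G f (n + 1) v) = 0 := by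
    intro n v
    refine sum_ext ?_ ?_
    · rw [cd_succ_fst, cd_succ_fst, cd_succ_snd, map_add, F.comp, hc]; simp
    · rw [cd_succ_snd, cd_succ_snd]; simp [G.comp]
  have hexz : ∀ a, ∀ u ∈ Lv k (Sum.elim (F.dg 1) (G.dg 0)) a, c0 F G f u = 0 →
      ∃ w ∈ Lv k (Sum.elim (F.dg 2) (G.dg 1)) a, cs F G f 0 w = u := by
    intro a u hu h0
    have hu2 := (mem_Lv_sum _ _ _ _).1 hu
    rw [cd_zero] at h0
    refine exaux 0 a u hu h0 (G.ex0 a _ hu2.2 ?_)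
    intro h1
    have h2 := congrArg F.ε h0
    rw [map_add, F.comp0 a _ hu2.1 (hQ a h1), he a (hQ a h1) _ hu2.2] at h2
    simpa using h2
  have hexs : ∀ n a, ∀ u ∈ Lv k (Sum.elim (F.dg (n + 2)) (G.dg (n + 1))) a, cs F G f n u = 0 →
      ∃ w ∈ Lv k (Sum.elim (F.dg (n + 3)) (G.dg (n + 2))) a, cs F G f (n + 1) w = u := by
    intro n a u hu h0
    have hu2 := (mem_Lv_sum _ _ _ _).1 hu
    have h1 := cd_succ_fst F G f n u
    have h2 := cd_succ_snd F G f n u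
    rw [h0, map_zero] at h1 h2
    exact exaux (n + 1) a u hu h1.symm (G.ex n a _ hu2.2 (by simpa using h2.symm))
  exact
  { ι := cι F G
    dg := cdg F G
    fin := by
      intro n a
      cases n with
      | zero => exact F.fin 0 a
      | succ n => exact (fin_sum _ _ a (F.fin (n + 1) a) (G.fin n a)).1
    d := cd F G f
    ε := ε'
    filt := fun n => match n with
      | 0 => filt0
      | n + 1 => filts n
    eps := heps
    surj := hsurj
    ex0 := hex0
    comp0 := hcomp0
    comp := fun n => match n with
      | 0 => hcompz
      | n + 1 => hcomps n
    ex := fun n => match n with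
      | 0 => hexz
      | n + 1 => hexs n }

end Cone

section Shift
variable {k : Type*} [Field k] {σ : Type}

theorem mem_Lv_shift {ι : Type} (dg : ι → (σ →₀ ℕ)) (c a : σ →₀ ℕ) (v : ι →₀ k) :
    v ∈ Lv k (fun i => dg i + c) a ↔ (c ≤ a ∧ v ∈ Lv k dg (a - c)) ∨ v = 0 := by
  by_cases hc : c ≤ a
  · have : {i | dg i + c ≤ a} = {i | dg i ≤ a - c} := by
      ext i; exact (le_tsub_iff_right hc).symm
    simp only [Lv, this, hc, true_and]
    constructor
    · exact Or.inl
    · rintro (h | rfl)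
      · exact h
      · exact Submodule.zero_mem _
  · have : {i | dg i + c ≤ a} = ∅ := by
      ext i
      simp only [Set.mem_ofPred_eq, Set.mem_empty_iff_false, iff_false]
      exact fun h => hc (le_trans (le_add_of_nonneg_left (zero_le)) h)
    simp [Lv, this, hc]

/-- shifted resolution -/
def shift {Q : (σ →₀ ℕ) → Prop} (F : FRes k Q) (c : σ →₀ ℕ) :
    FRes k (fun a => c ≤ a ∧ Q (a - c)) where
  ι := F.ι
  dg := fun n i => F.dg n i + c
  fin := by
    intro n a
    have := F.fin n (a - c)
    refine Finite.of_injective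
      (fun i : {i : F.ι n // F.dg n i + c = a} => (⟨i.1, eq_tsub_of_add_eq i.2⟩ : {i : F.ι n // F.dg n i = a - c})) ?_
    intro i j h
    exact Subtype.ext (congrArg (fun x => x.1) h)
  d := F.d
  ε := F.ε
  filt := by
    intro n i
    have := F.filt n i
    simpa [Ls] using this
  eps := by
    intro i h
    simpa using F.eps i h
  surj := by
    rintro a ⟨h1, h2⟩
    obtain ⟨v, hv, h3⟩ := F.surj _ h2
    exact ⟨v, (mem_Lv_shift _ _ _ _).2 (Or.inl ⟨h1, hv⟩), h3⟩
  ex0 := by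
    intro a v hv h
    rcases (mem_Lv_shift _ _ _ _).1 hv with ⟨h1, h2⟩ | rfl
    · obtain ⟨w, hw, h3⟩ := F.ex0 _ _ h2 (fun hq => h ⟨h1, hq⟩)
      exact ⟨w, (mem_Lv_shift _ _ _ _).2 (Or.inl ⟨h1, hw⟩), h3⟩
    · exact ⟨0, Submodule.zero_mem _, by simp⟩
  comp0 := by
    intro a v hv h
    rcases (mem_Lv_shift _ _ _ _).1 hv with ⟨h1, h2⟩ | rfl
    · exact F.comp0 _ _ h2 h.2
    · simp
  comp := F.comp
  ex := by
    intro n a v hv h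
    rcases (mem_Lv_shift _ _ _ _).1 hv with ⟨h1, h2⟩ | rfl
    · obtain ⟨w, hw, h3⟩ := F.ex _ _ _ h2 h
      exact ⟨w, (mem_Lv_shift _ _ _ _).2 (Or.inl ⟨h1, hw⟩), h3⟩
    · exact ⟨0, Submodule.zero_mem _, by simp⟩

theorem betti_shift {Q : (σ →₀ ℕ) → Prop} (F : FRes k Q) (c : σ →₀ ℕ) (n : ℕ) (a : σ →₀ ℕ) :
    (shift F c).betti n a = if c ≤ a then F.betti n (a - c) else 0 := by
  change Nat.card {i : F.ι n // F.dg n i + c = a} = if c ≤ a then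
    Nat.card {i : F.ι n // F.dg n i = a - c} else 0
  split_ifs with h
  · refine Nat.card_congr (Equiv.subtypeEquivRight fun i => ?_)
    exact (eq_tsub_iff_add_eq_of_le h).symm
  · have : IsEmpty {i : F.ι n // F.dg n i + c = a} :=
      ⟨fun i => h (by rw [← i.2]; exact le_add_of_nonneg_left (zero_le))⟩
    exact Nat.card_of_isEmpty

/-- `β` is the table of Betti numbers of a resolution for `Q` -/
def HasB (k : Type*) [Field k] (Q : (σ →₀ ℕ) → Prop) (β : ℕ → (σ →₀ ℕ) → ℕ) : Prop :=
  ∃ F : FRes k Q, ∀ n a, F.betti n a = β n a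

theorem HasB.unique {Q : (σ →₀ ℕ) → Prop} {β β' : ℕ → (σ →₀ ℕ) → ℕ} (h : HasB k Q β)
    (h' : HasB k Q β') (n a) : β n a = β' n a := by
  obtain ⟨F, hF⟩ := h
  obtain ⟨G, hG⟩ := h'
  rw [← hF, ← hG]
  exact le_antisymm (betti_le F G n a) (betti_le G F n a)

theorem HasB.cone {Q Q2 : (σ →₀ ℕ) → Prop} {β β2 : ℕ → (σ →₀ ℕ) → ℕ} (h : HasB k Q β)
    (h2 : HasB k Q2 β2) (x y : σ →₀ ℕ) (hy : 0 < y) (hdown : ∀ a b, a ≤ b → Q b → Q a)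
    (hx : ∀ a, Q (a + x) → Q2 a) (hxy : ∀ a, Q2 a ↔ Q (a + (x + y))) :
    HasB k (fun a => Q a ∧ ¬ (x + y ≤ a)) (fun n a => β n a +
      if 1 ≤ n ∧ x + y ≤ a then β2 (n - 1) (a - (x + y)) else 0) := by
  obtain ⟨F, hF⟩ := h
  obtain ⟨G, hG⟩ := h2
  let G1 := shift G x
  let G2 := shift G (x + y)
  have H : Compat (fun a => x ≤ a ∧ Q2 (a - x)) Q := by
    rintro a b hab ⟨h1, h2⟩ hb
    refine ⟨hdown _ _ hab hb, h1.trans hab, hx _ ?_⟩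
    rwa [tsub_add_cancel_of_le (h1.trans hab)]
  let C := BalSq.cone F G2 (cmp G1 F) (by
      intro n i
      have := cmp_filt G1 F n i
      refine Lv_le_Ls _ ?_ this
      change G.dg n i + x < G.dg n i + (x + y)
      rw [← add_assoc]
      exact lt_add_of_pos_right _ hy) (cmp_comm G1 F H) (by
      intro b hb v hv
      refine cmp_eps G1 F H hb ?_
      refine Finsupp.supported_mono ?_ hv
      intro i (hi : G.dg 0 i + (x + y) ≤ b)
      refine le_trans ?_ hi
      exact add_le_add_right (le_add_of_nonneg_right (zero_le)) _) (by
      rintro a ⟨h1, h2⟩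
      have := (hxy _).1 h2
      rwa [tsub_add_cancel_of_le h1] at this) (by
      rintro a b hab ⟨h1, h2⟩ hb
      refine ⟨h1.trans hab, (hxy _).2 ?_⟩
      rwa [tsub_add_cancel_of_le (h1.trans hab)])
  have hQ : (fun a => Q a ∧ ¬ (x + y ≤ a ∧ Q2 (a - (x + y)))) = fun a => Q a ∧ ¬ (x + y ≤ a) := by
    funext a
    apply propext
    constructor
    · rintro ⟨h1, h2⟩
      refine ⟨h1, fun h3 => h2 ⟨h3, (hxy _).2 ?_⟩⟩
      rwa [tsub_add_cancel_of_le h3]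
    · rintro ⟨h1, h2⟩
      exact ⟨h1, fun h3 => h2 h3.1⟩
  rw [← hQ]
  refine ⟨C, ?_⟩
  intro n a
  cases n with
  | zero =>
    simp only [nonpos_iff_eq_zero, one_ne_zero, false_and, if_false, add_zero]
    exact hF 0 a
  | succ n =>
    have e1 : C.betti (n + 1) a = F.betti (n + 1) a + G2.betti n a :=
      (fin_sum _ _ a (F.fin (n + 1) a) (G2.fin n a)).2
    rw [e1, hF, betti_shift]
    simp [hG]

end Shift

section Convert
variable {k : Type*} [Field k] {σ : Type}

open MvPolynomial in
/-- degree-`a` component -/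
def hcomp {ι : Type} (dg : ι → (σ →₀ ℕ)) (a : σ →₀ ℕ) :
    (ι →₀ MvPolynomial σ k) →ₗ[k] (ι →₀ k) where
  toFun p := Finsupp.onFinset p.support
    (fun j => if dg j ≤ a then coeff (a - dg j) (p j) else 0) (by
      intro j h
      rw [Finsupp.mem_support_iff]
      intro h0
      apply h
      simp [h0])
  map_add' p q := by
    ext j
    simp only [Finsupp.onFinset_apply, Finsupp.add_apply, coeff_add]
    split_ifs <;> simp
  map_smul' c p := by
    ext j
    simp only [Finsupp.onFinset_apply, Finsupp.smul_apply, coeff_smul, RingHom.id_apply]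
    split_ifs <;> simp

open MvPolynomial

theorem hcomp_apply {ι : Type} (dg : ι → (σ →₀ ℕ)) (a : σ →₀ ℕ) (p : ι →₀ MvPolynomial σ k) (j) :
    hcomp dg a p j = if dg j ≤ a then coeff (a - dg j) (p j) else 0 := rfl

theorem hcomp_mem {ι : Type} (dg : ι → (σ →₀ ℕ)) (a : σ →₀ ℕ) (p : ι →₀ MvPolynomial σ k) :
    hcomp dg a p ∈ Lv k dg a := by
  refine (Finsupp.mem_supported' k _).2 ?_
  intro i hi
  have hi : ¬ dg i ≤ a := hi
  rw [hcomp_apply, if_neg hi]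

theorem hcomp_single {ι : Type} (dg : ι → (σ →₀ ℕ)) (a μ : σ →₀ ℕ) (i : ι) (c : k) :
    hcomp dg a (Finsupp.single i (monomial μ c)) =
      if μ + dg i = a then c • Finsupp.single i 1 else 0 := by
  ext j
  rw [hcomp_apply]
  by_cases hij : i = j
  · subst hij
    rw [Finsupp.single_eq_same, coeff_monomial]
    by_cases h : dg i ≤ a
    · rw [if_pos h]
      have : (μ = a - dg i) ↔ μ + dg i = a := eq_tsub_iff_add_eq_of_le h
      by_cases h2 : μ + dg i = a
      · rw [if_pos (this.2 h2), if_pos h2]; simp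
      · rw [if_neg (fun h3 => h2 (this.1 h3)), if_neg h2]; simp
    · rw [if_neg h, if_neg]
      · simp
      · intro h2
        exact h (by rw [← h2]; exact le_add_of_nonneg_left zero_le)
  · rw [Finsupp.single_eq_of_ne' hij]
    split_ifs <;> simp [Finsupp.single_eq_of_ne' hij]

theorem hcomp_smul {ι : Type} (dg : ι → (σ →₀ ℕ)) (a b μ : σ →₀ ℕ) (c : k)
    (q : ι →₀ MvPolynomial σ k) (hq : ∀ j ν, coeff ν (q j) ≠ 0 → ν + dg j = b) :
    hcomp dg a (monomial μ c • q) = if μ + b = a then c • hcomp dg b q else 0 := by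
  ext j
  rw [hcomp_apply, Finsupp.smul_apply, smul_eq_mul, coeff_monomial_mul']
  by_cases h : μ + b = a
  · rw [if_pos h, Finsupp.smul_apply, hcomp_apply]
    by_cases hj : dg j ≤ b
    · have h1 : dg j ≤ a := by rw [← h]; exact hj.trans (le_add_of_nonneg_left zero_le)
      have h2 : a - dg j = μ + (b - dg j) := by rw [← h, add_tsub_assoc_of_le hj]
      rw [if_pos h1, if_pos hj, h2, if_pos (le_add_of_nonneg_right zero_le),
        add_tsub_cancel_left, smul_eq_mul]
    · rw [if_neg hj]
      split_ifs with h1 h2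
      · have : coeff (a - dg j - μ) (q j) = 0 := by
          by_contra h3
          have h4 := hq _ _ h3
          exact hj (by rw [← h4]; exact le_add_of_nonneg_left zero_le)
        simp [this]
      · simp
      · simp
  · rw [if_neg h]
    split_ifs with h1 h2
    · have : coeff (a - dg j - μ) (q j) = 0 := by
        by_contra h3
        have h4 := hq _ _ h3
        apply h
        rw [← h4, ← add_assoc, add_tsub_cancel_of_le h2, tsub_add_cancel_of_le h1]
      simp [this]
    · simp
    · simp

theorem coeff_mul_hom (a b μ : σ →₀ ℕ) (c : k)
    (q : MvPolynomial σ k) (hq : ∀ ν, coeff ν q ≠ 0 → ν = b) :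
    coeff a (monomial μ c * q) = if μ + b = a then c * coeff b q else 0 := by
  rw [coeff_monomial_mul']
  by_cases h : μ + b = a
  · rw [if_pos h, if_pos (by rw [← h]; exact le_add_of_nonneg_right zero_le), ← h,
      add_tsub_cancel_left]
  · rw [if_neg h]
    split_ifs with h1
    · have : coeff (a - μ) q = 0 := by
        by_contra h3
        apply h
        rw [← hq _ h3, add_tsub_cancel_of_le h1]
      simp [this]
    · rfl

theorem hcomp_ext {ι : Type} (dg : ι → (σ →₀ ℕ)) {p q : ι →₀ MvPolynomial σ k}
    (h : ∀ b, hcomp dg b p = hcomp dg b q) : p = q := by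
  ext j μ
  have := DFunLike.congr_fun (h (μ + dg j)) j
  rw [hcomp_apply, hcomp_apply, if_pos (le_add_of_nonneg_left zero_le),
    add_tsub_cancel_right] at this
  simpa using this

/-- homogenization in degree `a` -/
def homg {ι : Type} (dg : ι → (σ →₀ ℕ)) (a : σ →₀ ℕ) :
    (ι →₀ k) →ₗ[k] (ι →₀ MvPolynomial σ k) :=
  lext fun i => Finsupp.single i (monomial (a - dg i) 1)

theorem hcomp_homg {ι : Type} (dg : ι → (σ →₀ ℕ)) (a b : σ →₀ ℕ) {v : ι →₀ k}
    (hv : v ∈ Lv k dg a) : hcomp dg b (homg dg a v) = if b = a then v else 0 := by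
  have : (if b = a then v else 0) = (if b = a then (LinearMap.id : (ι →₀ k) →ₗ[k] _) else 0) v := by
    split_ifs <;> rfl
  rw [this, ← LinearMap.comp_apply]
  refine eq_on_of _ _ _ ?_ hv
  intro i (hi : dg i ≤ a)
  rw [LinearMap.comp_apply, homg, lext_single, hcomp_single, tsub_add_cancel_of_le hi]
  by_cases h : b = a
  · subst h; simp
  · rw [if_neg (Ne.symm h), if_neg h]; rfl

/-- scalar version of a map -/
def scal {ι κ : Type} (di : ι → (σ →₀ ℕ)) (dk : κ → (σ →₀ ℕ))
    (φ : (ι →₀ MvPolynomial σ k) →ₗ[MvPolynomial σ k] (κ →₀ MvPolynomial σ k)) :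
    (ι →₀ k) →ₗ[k] (κ →₀ k) :=
  lext fun i => hcomp dk (di i) (φ (Finsupp.single i 1))

theorem poly_ind {ι : Type} {P : (ι →₀ MvPolynomial σ k) → Prop} (h0 : P 0)
    (hadd : ∀ p q, P p → P q → P (p + q))
    (hm : ∀ i μ c, P (Finsupp.single i (monomial μ c))) (p) : P p := by
  induction p using Finsupp.induction_linear with
  | zero => exact h0
  | add p q hp hq => exact hadd p q hp hq
  | single i q =>
    induction q using MvPolynomial.induction_on' with
    | monomial μ c => exact hm i μ c
    | add p q hp hq => rw [Finsupp.single_add]; exact hadd _ _ hp hq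

theorem single_mono {ι : Type} (i : ι) (μ : σ →₀ ℕ) (c : k) :
    (Finsupp.single i (monomial μ c) : ι →₀ MvPolynomial σ k) =
      monomial μ c • Finsupp.single i 1 := by
  simp

theorem scal_hcomp {ι κ : Type} (di : ι → (σ →₀ ℕ)) (dk : κ → (σ →₀ ℕ))
    (φ : (ι →₀ MvPolynomial σ k) →ₗ[MvPolynomial σ k] (κ →₀ MvPolynomial σ k))
    (hφ : ∀ i j ν, coeff ν (φ (Finsupp.single i 1) j) ≠ 0 → ν + dk j = di i) (a) (p) :
    scal di dk φ (hcomp di a p) = hcomp dk a (φ p) := by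
  induction p using poly_ind with
  | h0 => simp
  | hadd p q hp hq => rw [map_add, map_add, hp, hq, map_add, map_add]
  | hm i μ c =>
    rw [hcomp_single, single_mono, map_smul, hcomp_smul dk a (di i) μ c _ (hφ i)]
    split_ifs
    · rw [map_smul, scal, lext_single]
    · simp

/-- scalar version of the augmentation -/
def scalε {ι : Type} (di : ι → (σ →₀ ℕ))
    (φ : (ι →₀ MvPolynomial σ k) →ₗ[MvPolynomial σ k] MvPolynomial σ k) : (ι →₀ k) →ₗ[k] k :=
  lext fun i => coeff (di i) (φ (Finsupp.single i 1))

theorem scalε_hcomp {ι : Type} (di : ι → (σ →₀ ℕ))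
    (φ : (ι →₀ MvPolynomial σ k) →ₗ[MvPolynomial σ k] MvPolynomial σ k)
    (hφ : ∀ i ν, coeff ν (φ (Finsupp.single i 1)) ≠ 0 → ν = di i) (a) (p) :
    scalε di φ (hcomp di a p) = coeff a (φ p) := by
  induction p using poly_ind with
  | h0 => simp
  | hadd p q hp hq => rw [map_add, map_add, hp, hq, map_add, coeff_add]
  | hm i μ c =>
    rw [hcomp_single, single_mono, map_smul, smul_eq_mul, coeff_mul_hom a (di i) μ c _ (hφ i)]
    split_ifs
    · rw [map_smul, scalε, lext_single, smul_eq_mul]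
    · simp

theorem hasB_of_res (I : Ideal (MvPolynomial σ k))
    (hI : ∀ p ∈ I, ∀ a, coeff a p ≠ 0 → monomial a (1 : k) ∈ I)
    (β : ℕ → (σ →₀ ℕ) → ℕ) (h : IsMinFreeRes σ k id I β) :
    HasB k (fun a => monomial a (1 : k) ∉ I) β := by
  obtain ⟨dm, ε, h1, h2, h3, h4, h5, h6⟩ := h
  let ι : ℕ → Type := fun n => Σ a, Fin (β n a)
  let dg : ∀ n, ι n → (σ →₀ ℕ) := fun n i => i.1
  have hd : ∀ n i j ν, coeff ν (dm n (Finsupp.single i 1) j) ≠ 0 → ν + dg n j = dg (n + 1) i :=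
    fun n i j ν hh => h2 n i.1 i.2 j.1 j.2 ν hh
  have he : ∀ i ν, coeff ν (ε (Finsupp.single i 1)) ≠ 0 → ν = dg 0 i :=
    fun i ν hh => h1 i.1 i.2 ν hh
  let d : ∀ n, (ι (n + 1) →₀ k) →ₗ[k] (ι n →₀ k) := fun n => scal (dg (n + 1)) (dg n) (dm n)
  have dd : ∀ n a p, d n (hcomp (dg (n + 1)) a p) = hcomp (dg n) a (dm n p) :=
    fun n a p => scal_hcomp _ _ _ (hd n) a p
  let e := scalε (dg 0) ε
  have ee : ∀ a p, e (hcomp (dg 0) a p) = coeff a (ε p) := fun a p => scalε_hcomp _ _ he a p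
  have hup : ∀ a b : σ →₀ ℕ, a ≤ b → monomial b (1 : k) ∉ I → monomial a (1 : k) ∉ I := by
    intro a b hab hb ha
    apply hb
    have : monomial b (1 : k) = monomial (b - a) 1 * monomial a 1 := by
      rw [monomial_mul, tsub_add_cancel_of_le hab, one_mul]
    rw [this]
    exact I.mul_mem_left _ ha
  let e' : (ι 0 →₀ k) →ₗ[k] k := lext fun i =>
    if monomial (dg 0 i) (1 : k) ∉ I then e (Finsupp.single i 1) else 0
  have he' : ∀ a, monomial a (1 : k) ∉ I → ∀ v ∈ Lv k (dg 0) a, e' v = e v := by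
    intro a ha v hv
    refine eq_on_of e' e _ ?_ hv
    intro i hi
    simp only [e', lext_single]
    rw [if_pos (hup _ _ hi ha)]
  have hself : ∀ n a v, v ∈ Lv k (dg n) a → hcomp (dg n) a (homg (dg n) a v) = v := by
    intro n a v hv
    rw [hcomp_homg _ _ _ hv, if_pos rfl]
  have hdh : ∀ n a v, v ∈ Lv k (dg (n + 1)) a → d n v = 0 → dm n (homg (dg (n + 1)) a v) = 0 := by
    intro n a v hv h0
    refine hcomp_ext (dg n) fun b => ?_
    rw [← dd, hcomp_homg _ _ _ hv, map_zero]
    split_ifs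
    · exact h0
    · simp
  refine ⟨
    { ι := ι
      dg := dg
      fin := ?_
      d := d
      ε := e'
      filt := ?_
      eps := ?_
      surj := ?_
      ex0 := ?_
      comp0 := ?_
      comp := ?_
      ex := ?_ }, ?_⟩
  · intro n a
    exact Finite.of_equiv _ (Equiv.sigmaSubtype (β := fun a => Fin (β n a)) a).symm
  · intro n i
    refine (Finsupp.mem_supported' k _).2 ?_
    intro j hj
    have hj : ¬ dg n j < dg (n + 1) i := hj
    simp only [d, scal, lext_single]
    rw [hcomp_apply]
    split_ifs with h7
    · have h8 : dg n j = dg (n + 1) i := by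
        by_contra h9
        exact hj (lt_of_le_of_ne h7 h9)
      rw [h8, tsub_self]
      exact h3 n i.1 i.2 j.1 j.2
    · rfl
  · intro i h7
    simp only [e', lext_single] at h7
    by_contra h8
    exact h7 (if_neg (fun h => h (by simpa using h8)))
  · intro a ha
    have : (1 : MvPolynomial σ k) ∈ LinearMap.range ε ⊔ I := by rw [h4]; trivial
    obtain ⟨_, ⟨p, rfl⟩, g, hg, hpg⟩ := Submodule.mem_sup.1 this
    refine ⟨hcomp (dg 0) a (monomial a (1 : k) • p), hcomp_mem _ _ _, ?_⟩
    rw [he' a ha _ (hcomp_mem _ _ _), ee, map_smul, smul_eq_mul]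
    have h7 : monomial a (1 : k) * ε p = monomial a 1 - monomial a 1 * g := by
      rw [eq_sub_iff_add_eq, ← mul_add, hpg, mul_one]
    have h8 : coeff a (monomial a (1 : k) * g) = 0 := by
      by_contra h9
      exact ha (hI _ (I.mul_mem_left _ hg) a h9)
    rw [h7, coeff_sub, h8]
    simp
  · intro a v hv h7
    have h8 : homg (dg 0) a v ∈ LinearMap.range (dm 0) := by
      rw [h5, Submodule.mem_comap]
      have h9 : ε (homg (dg 0) a v) = C (e v) * monomial a 1 := by
        ext b
        rw [← ee, hcomp_homg _ _ _ hv, coeff_C_mul, coeff_monomial]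
        by_cases hb : b = a
        · rw [if_pos hb, if_pos hb.symm, mul_one]
        · rw [if_neg hb, if_neg (Ne.symm hb)]; simp
      rw [h9]
      by_cases ha : monomial a (1 : k) ∈ I
      · exact I.mul_mem_left _ ha
      · rw [← he' a ha v hv, h7 ha]; simp
    obtain ⟨w, hw⟩ := h8
    refine ⟨hcomp (dg 1) a w, hcomp_mem _ _ _, ?_⟩
    rw [dd, hw, hself _ _ _ hv]
  · intro a w hw ha
    have h7 : d 0 w = hcomp (dg 0) a (dm 0 (homg (dg 1) a w)) := by
      rw [← dd, hself _ _ _ hw]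
    rw [h7, he' a ha _ (hcomp_mem _ _ _), ee]
    by_contra h8
    refine ha (hI _ ?_ a h8)
    have : dm 0 (homg (dg 1) a w) ∈ LinearMap.range (dm 0) := ⟨_, rfl⟩
    rw [h5] at this
    exact this
  · intro n v
    have : d n ∘ₗ d (n + 1) = 0 := by
      refine Finsupp.lhom_ext' fun i => LinearMap.ext_ring ?_
      simp only [LinearMap.comp_apply, Finsupp.lsingle_apply, LinearMap.zero_apply]
      have h7 : d (n + 1) (Finsupp.single i 1) =
          hcomp (dg (n + 1)) (dg (n + 2) i) (dm (n + 1) (Finsupp.single i 1)) := by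
        simp only [d, scal, lext_single]
      rw [h7, dd]
      have h8 : dm (n + 1) (Finsupp.single i 1) ∈ LinearMap.ker (dm n) := by
        rw [← h6]; exact ⟨_, rfl⟩
      rw [LinearMap.mem_ker.1 h8, map_zero]
    exact LinearMap.congr_fun this v
  · intro n a v hv h0
    have h7 : homg (dg (n + 1)) a v ∈ LinearMap.range (dm (n + 1)) := by
      rw [h6, LinearMap.mem_ker]
      exact hdh n a v hv h0
    obtain ⟨w, hw⟩ := h7
    refine ⟨hcomp (dg (n + 2)) a w, hcomp_mem _ _ _, ?_⟩
    rw [dd, hw, hself _ _ _ hv]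
  · intro n a
    change Nat.card {i : Σ a, Fin (β n a) // i.1 = a} = β n a
    rw [Nat.card_congr (Equiv.sigmaSubtype (β := fun a => Fin (β n a)) a)]
    simp

end Convert

section Comb

/-- degree of the variable -/
def xd (v : Var d m) : Vtx d m →₀ ℕ := Finsupp.single (emb v) 1
/-- degree of the last variable of the same color -/
def yd (v : Var d m) : Vtx d m →₀ ℕ := Finsupp.single (⟨v.1, Fin.last (m v.1)⟩ : Vtx d m) 1
/-- degree of the monomial with given support -/
def sd (A : Finset (Var d m)) : Vtx d m →₀ ℕ := ∑ v ∈ A, xd v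

theorem emb_inj {v w : Var d m} (h : emb v = emb w) : v = w := by
  obtain ⟨i, j⟩ := v
  obtain ⟨i', j'⟩ := w
  simp only [emb, Sigma.mk.injEq] at h
  obtain ⟨rfl, h⟩ := h
  have := Fin.castSucc_injective _ (eq_of_heq h)
  rw [this]

theorem emb_ne_last (v w : Var d m) : emb v ≠ (⟨w.1, Fin.last (m w.1)⟩ : Vtx d m) := by
  obtain ⟨i, j⟩ := v
  obtain ⟨i', j'⟩ := w
  intro h
  simp only [emb, Sigma.mk.injEq] at h
  obtain ⟨rfl, h⟩ := h
  exact absurd (eq_of_heq h) (Fin.castSucc_lt_last j).ne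

theorem emb_ne_last' (v : Var d m) (t : Fin d) : emb v ≠ (⟨t, Fin.last (m t)⟩ : Vtx d m) := by
  obtain ⟨i, j⟩ := v
  intro h
  simp only [emb, Sigma.mk.injEq] at h
  obtain ⟨rfl, h⟩ := h
  exact absurd (eq_of_heq h) (Fin.castSucc_lt_last j).ne

theorem xd_le {v : Var d m} {a : Vtx d m →₀ ℕ} : xd v ≤ a ↔ 1 ≤ a (emb v) := by
  rw [xd, Finsupp.single_le_iff]

theorem yd_le {v : Var d m} {a : Vtx d m →₀ ℕ} :
    yd v ≤ a ↔ 1 ≤ a (⟨v.1, Fin.last (m v.1)⟩ : Vtx d m) := by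
  rw [yd, Finsupp.single_le_iff]

theorem add_le_of_disj {v w : Vtx d m} {a : Vtx d m →₀ ℕ} (h : v ≠ w) :
    Finsupp.single v 1 + Finsupp.single w 1 ≤ a ↔ 1 ≤ a v ∧ 1 ≤ a w := by
  constructor
  · intro h1
    have hv := h1 v
    have hw := h1 w
    simp only [Finsupp.add_apply, Finsupp.single_eq_same, Finsupp.single_eq_of_ne h,
      Finsupp.single_eq_of_ne h.symm] at hv hw
    exact ⟨by omega, by omega⟩
  · rintro ⟨h1, h2⟩ t
    simp only [Finsupp.add_apply, Finsupp.single_apply]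
    split_ifs with h3 h4 h4
    · exact absurd (h3.trans h4.symm) h
    · subst h3; omega
    · subst h4; omega
    · omega

theorem xyd_le {v : Var d m} {a : Vtx d m →₀ ℕ} :
    xd v + yd v ≤ a ↔ 1 ≤ a (emb v) ∧ 1 ≤ a (⟨v.1, Fin.last (m v.1)⟩ : Vtx d m) :=
  add_le_of_disj (emb_ne_last v v)

theorem sd_insert {v : Var d m} {B : Finset (Var d m)} (h : v ∉ B) :
    sd (insert v B) = xd v + sd B := by
  rw [sd, Finset.sum_insert h]; rfl

theorem shiftDeg_insert {v : Var d m} {B : Finset (Var d m)} (h : v ∉ B) :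
    shiftDeg (insert v B) = xd v + yd v + shiftDeg B := by
  rw [shiftDeg, Finset.sum_insert h]; rfl

/-- degrees in the intermediate ideals -/
def Dead (E : (Vtx d m →₀ ℕ) → Prop) (T B : Finset (Var d m)) (a : Vtx d m →₀ ℕ) : Prop :=
  E (a + sd B) ∨ ∃ v ∈ T, xd v + yd v ≤ a

theorem dead_mono {E : (Vtx d m →₀ ℕ) → Prop} (hE : ∀ a b, a ≤ b → E a → E b)
    (T B : Finset (Var d m)) {a b : Vtx d m →₀ ℕ} (h : a ≤ b) (ha : Dead E T B a) :
    Dead E T B b := by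
  rcases ha with ha | ⟨v, hv, ha⟩
  · exact Or.inl (hE _ _ (add_le_add_left h _) ha)
  · exact Or.inr ⟨v, hv, ha.trans h⟩

theorem dead_one {E : (Vtx d m →₀ ℕ) → Prop}
    {T B : Finset (Var d m)} {v : Var d m} (hvB : v ∉ B) {a : Vtx d m →₀ ℕ}
    (h : Dead E (T.filter fun w => w.1 ≠ v.1) (insert v B) a) : Dead E T B (a + xd v) := by
  rcases h with h | ⟨w, hw, h⟩
  · left
    rw [sd_insert hvB, ← add_assoc] at h
    exact h
  · exact Or.inr ⟨w, (Finset.mem_filter.1 hw).1, h.trans (le_add_of_nonneg_right zero_le)⟩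

theorem dead_two {E : (Vtx d m →₀ ℕ) → Prop} (hE : ∀ a b, a ≤ b → E a → E b)
    (hy : ∀ a (v : Var d m), E (a + yd v) → E a)
    (hbr : ∀ v w : Var d m, v ≠ w → v.1 = w.1 → E (xd v + xd w))
    {T B : Finset (Var d m)} {v : Var d m} (hvT : v ∉ T) (hvB : v ∉ B) (a : Vtx d m →₀ ℕ) :
    Dead E (T.filter fun w => w.1 ≠ v.1) (insert v B) a ↔ Dead E T B (a + (xd v + yd v)) := by
  constructor
  · intro h
    refine dead_mono hE _ _ ?_ (dead_one hvB h)
    rw [← add_assoc]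
    exact le_add_of_nonneg_right zero_le
  · rintro (h | ⟨w, hw, h⟩)
    · left
      apply hy _ v
      rw [sd_insert hvB]
      convert h using 1
      abel
    · have hwv : w ≠ v := fun h => hvT (h ▸ hw)
      rw [xyd_le] at h
      have h1 : 1 ≤ a (emb w) := by
        have := h.1
        simp only [Finsupp.add_apply, xd, yd] at this
        rwa [Finsupp.single_eq_of_ne' (fun h => hwv (emb_inj h).symm),
          Finsupp.single_eq_of_ne' (emb_ne_last w v).symm] at this
      by_cases hc : w.1 = v.1
      · left
        refine hE _ _ ?_ (hbr w v hwv hc)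
        rw [sd_insert hvB]
        refine add_le_add (xd_le.2 h1) (le_add_of_nonneg_right zero_le)
      · right
        refine ⟨w, Finset.mem_filter.2 ⟨hw, hc⟩, xyd_le.2 ⟨h1, ?_⟩⟩
        have hne : (⟨v.1, Fin.last (m v.1)⟩ : Vtx d m) ≠ ⟨w.1, Fin.last (m w.1)⟩ :=
          fun h => hc (congrArg Sigma.fst h).symm
        have := h.2
        simp only [Finsupp.add_apply, xd, yd] at this
        rwa [Finsupp.single_eq_of_ne' (emb_ne_last v w),
          Finsupp.single_eq_of_ne' hne] at this

/-- the predicted Betti table -/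
def bt (βu : Finset (Var d m) → ℕ → (Vtx d m →₀ ℕ) → ℕ) (T B : Finset (Var d m))
    (k : ℕ) (a : Vtx d m →₀ ℕ) : ℕ :=
  ∑ A ∈ T.powerset.filter CSFSet,
    if A.card ≤ k ∧ shiftDeg A ≤ a then βu (A ∪ B) (k - A.card) (a - shiftDeg A) else 0

theorem csf_insert {v : Var d m} {A T : Finset (Var d m)} (hA : A ⊆ T) (hv : v ∉ T) :
    CSFSet (insert v A) ↔ A ⊆ T.filter (fun w => w.1 ≠ v.1) ∧ CSFSet A := by
  constructor
  · intro h
    refine ⟨fun w hw => Finset.mem_filter.2 ⟨hA hw, fun hc => ?_⟩, fun u hu w hw huw => ?_⟩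
    · have := h w (Finset.mem_insert_of_mem hw) v (Finset.mem_insert_self _ _) hc
      exact hv (this ▸ hA hw)
    · exact h u (Finset.mem_insert_of_mem hu) w (Finset.mem_insert_of_mem hw) huw
  · rintro ⟨h1, h2⟩ u hu w hw huw
    rcases Finset.mem_insert.1 hu with hu' | hu' <;> rcases Finset.mem_insert.1 hw with hw' | hw'
    · rw [hu', hw']
    · subst hu'; exact absurd huw.symm (Finset.mem_filter.1 (h1 hw')).2
    · subst hw'; exact absurd huw (Finset.mem_filter.1 (h1 hu')).2
    · exact h2 u hu' w hw' huw

theorem bt_insert (βu : Finset (Var d m) → ℕ → (Vtx d m →₀ ℕ) → ℕ) {T B : Finset (Var d m)}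
    {v : Var d m} (hvT : v ∉ T) (k : ℕ) (a : Vtx d m →₀ ℕ) :
    bt βu (insert v T) B k a = bt βu T B k a +
      if 1 ≤ k ∧ xd v + yd v ≤ a then
        bt βu (T.filter fun w => w.1 ≠ v.1) (insert v B) (k - 1) (a - (xd v + yd v)) else 0 := by
  unfold bt
  rw [Finset.sum_filter, Finset.sum_powerset_insert hvT, ← Finset.sum_filter]
  congr 1
  have hset : T.powerset.filter (fun A => CSFSet (insert v A)) =
      (T.filter fun w => w.1 ≠ v.1).powerset.filter CSFSet := by
    ext A
    simp only [Finset.mem_filter, Finset.mem_powerset]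
    constructor
    · rintro ⟨h1, h2⟩
      exact (csf_insert h1 hvT).1 h2
    · rintro ⟨h1, h2⟩
      have h3 : A ⊆ T := h1.trans (Finset.filter_subset _ _)
      exact ⟨h3, (csf_insert h3 hvT).2 ⟨h1, h2⟩⟩
  rw [← Finset.sum_filter, hset]
  have key : ∀ A ∈ (T.filter fun w => w.1 ≠ v.1).powerset.filter CSFSet,
      (if (insert v A).card ≤ k ∧ shiftDeg (insert v A) ≤ a then
        βu (insert v A ∪ B) (k - (insert v A).card) (a - shiftDeg (insert v A)) else 0) =
      if 1 ≤ k ∧ xd v + yd v ≤ a then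
        (if A.card ≤ k - 1 ∧ shiftDeg A ≤ a - (xd v + yd v) then
          βu (A ∪ insert v B) (k - 1 - A.card) (a - (xd v + yd v) - shiftDeg A) else 0) else 0 := by
    intro A hA
    have h3 : A ⊆ T := (Finset.mem_powerset.1 (Finset.mem_filter.1 hA).1).trans
      (Finset.filter_subset _ _)
    have hvA : v ∉ A := fun h => hvT (h3 h)
    rw [shiftDeg_insert hvA, Finset.card_insert_of_notMem hvA]
    have hun : insert v A ∪ B = A ∪ insert v B := by
      rw [Finset.insert_union, Finset.union_insert]
    rw [hun]
    by_cases h1 : 1 ≤ k ∧ xd v + yd v ≤ a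
    · rw [if_pos h1]
      have e1 : (A.card + 1 ≤ k ∧ xd v + yd v + shiftDeg A ≤ a) ↔
          (A.card ≤ k - 1 ∧ shiftDeg A ≤ a - (xd v + yd v)) := by
        rw [le_tsub_iff_left h1.2, Nat.le_sub_iff_add_le h1.1]
      have e2 : k - (A.card + 1) = k - 1 - A.card := by omega
      rw [e2, ← tsub_tsub]
      by_cases h4 : A.card + 1 ≤ k ∧ xd v + yd v + shiftDeg A ≤ a
      · rw [if_pos h4, if_pos (e1.1 h4)]
      · rw [if_neg h4, if_neg (fun h => h4 (e1.2 h))]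
    · rw [if_neg h1, if_neg]
      rintro ⟨h4, h5⟩
      exact h1 ⟨by omega, (le_add_of_nonneg_right zero_le).trans h5⟩
  rw [Finset.sum_congr rfl key]
  split_ifs with h
  · rfl
  · simp

theorem main_ind {E : (Vtx d m →₀ ℕ) → Prop} (hE : ∀ a b, a ≤ b → E a → E b)
    (hy : ∀ a (v : Var d m), E (a + yd v) → E a)
    (hbr : ∀ v w : Var d m, v ≠ w → v.1 = w.1 → E (xd v + xd w))
    (βu : Finset (Var d m) → ℕ → (Vtx d m →₀ ℕ) → ℕ)
    (h0 : ∀ B, CSFSet B → HasB K (fun a => ¬ E (a + sd B)) (βu B)) (n : ℕ) :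
    ∀ T B : Finset (Var d m), T.card ≤ n → CSFSet B → (∀ v ∈ T, ∀ w ∈ B, v.1 ≠ w.1) →
      HasB K (fun a => ¬ Dead E T B a) (bt βu T B) := by
  have hempty : ∀ B, CSFSet B → HasB K (fun a => ¬ Dead E ∅ B a) (bt βu ∅ B) := by
    intro B hB
    have e1 : (fun a => ¬ Dead E ∅ B a) = fun a => ¬ E (a + sd B) := by
      funext a
      simp [Dead]
    have e2 : bt βu ∅ B = βu B := by
      funext k a
      have : CSFSet (∅ : Finset (Var d m)) := by intro v hv; simp at hv
      simp [bt, Finset.filter_singleton, this, shiftDeg]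
    rw [e1, e2]
    exact h0 B hB
  induction n with
  | zero =>
    intro T B hT hB _
    obtain rfl : T = ∅ := Finset.card_eq_zero.1 (Nat.le_zero.1 hT)
    exact hempty B hB
  | succ n ih =>
    intro T B hT hB hTB
    rcases Finset.eq_empty_or_nonempty T with rfl | ⟨v, hv⟩
    · exact hempty B hB
    obtain ⟨T', hvT, rfl⟩ : ∃ T', v ∉ T' ∧ insert v T' = T :=
      ⟨T.erase v, Finset.notMem_erase _ _, Finset.insert_erase hv⟩
    rw [Finset.card_insert_of_notMem hvT] at hT
    have hvB : v ∉ B := fun h => hTB v hv v h rfl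
    have hA := ih T' B (by omega) hB (fun w hw => hTB w (Finset.mem_insert_of_mem hw))
    have hB' : CSFSet (insert v B) := by
      intro u hu w hw huw
      rcases Finset.mem_insert.1 hu with hu' | hu' <;> rcases Finset.mem_insert.1 hw with hw' | hw'
      · rw [hu', hw']
      · subst hu'; exact absurd huw (hTB _ hv _ hw')
      · subst hw'; exact absurd huw.symm (hTB _ hv _ hu')
      · exact hB u hu' w hw' huw
    have hA2 := ih (T'.filter fun w => w.1 ≠ v.1) (insert v B)
      ((Finset.card_filter_le _ _).trans (by omega)) hB' (by
        intro w hw u hu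
        obtain ⟨hw1, hw2⟩ := Finset.mem_filter.1 hw
        rcases Finset.mem_insert.1 hu with rfl | hu
        · exact hw2
        · exact hTB w (Finset.mem_insert_of_mem hw1) u hu)
    have hypos : 0 < yd v := by
      rw [pos_iff_ne_zero]
      simp [yd]
    have := HasB.cone hA hA2 (xd v) (yd v) hypos
      (fun a b hab hb ha => hb (dead_mono hE _ _ hab ha))
      (fun a ha h => ha (dead_one hvB h))
      (fun a => not_congr (dead_two hE hy hbr hvT hvB a))
    have e1 : (fun a => ¬ Dead E (insert v T') B a) =
        fun a => ¬ Dead E T' B a ∧ ¬ (xd v + yd v ≤ a) := by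
      funext a
      simp only [Dead, Finset.exists_mem_insert, eq_iff_iff]
      generalize E (a + sd B) = p1
      generalize (xd v + yd v ≤ a) = p2
      generalize (∃ x ∈ T', xd x + yd x ≤ a) = p3
      tauto
    have e2 : bt βu (insert v T') B = fun n a => bt βu T' B n a +
        if 1 ≤ n ∧ xd v + yd v ≤ a then
          bt βu (T'.filter fun w => w.1 ≠ v.1) (insert v B) (n - 1) (a - (xd v + yd v)) else 0 := by
      funext k a
      exact bt_insert βu hvT k a
    rw [e1, e2]
    exact this

end Comb

section Fin1
open MvPolynomial

/-- exponents of generators of the extended ideal -/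
def GE (S : Set (Mon d m)) : Set (Vtx d m →₀ ℕ) :=
  (Finsupp.mapDomain emb '' S) ∪ {w | ∃ (i : Fin d) (j k : Fin (m i)), j < k ∧
    w = xd ⟨i, j⟩ + xd ⟨i, k⟩}

/-- exponents of generators of the last ideal -/
def GLast : Set (Vtx d m →₀ ℕ) := {w | ∃ v : Var d m, w = xd v + yd v}

theorem extBr_eq (S : Set (Mon d m)) :
    extBr K (Ideal.span (mon K '' S)) = Ideal.span ((fun s => monomial s (1 : K)) '' GE S) := by
  rw [extBr, brIdeal, Ideal.map_span, ← Ideal.span_union, GE, Set.image_union]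
  congr 2
  · rw [Set.image_image, Set.image_image]
    refine Set.image_congr fun u _ => ?_
    simp only [mon]
    exact rename_monomial _ _ _
  · ext p
    constructor
    · rintro ⟨i, j, k, h, rfl⟩
      refine ⟨_, ⟨i, j, k, h, rfl⟩, ?_⟩
      simp only [xd, emb, X, monomial_mul, one_mul]
    · rintro ⟨_, ⟨i, j, k, h, rfl⟩, rfl⟩
      refine ⟨i, j, k, h, ?_⟩
      simp only [xd, emb, X, monomial_mul, one_mul]

theorem lastIdeal_eq :
    lastIdeal (d := d) (m := m) K = Ideal.span ((fun s => monomial s (1 : K)) '' GLast) := by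
  rw [lastIdeal]
  congr 1
  ext p
  constructor
  · rintro ⟨i, j, rfl⟩
    refine ⟨_, ⟨⟨i, j⟩, rfl⟩, ?_⟩
    simp only [xd, yd, emb, X, monomial_mul, one_mul]
    rw [add_comm]
  · rintro ⟨_, ⟨⟨i, j⟩, rfl⟩, rfl⟩
    refine ⟨i, j, ?_⟩
    simp only [xd, yd, emb, X, monomial_mul, one_mul]
    rw [add_comm]

theorem mono_mem {σ : Type} (G : Set (σ →₀ ℕ)) (a : σ →₀ ℕ) :
    monomial a (1 : K) ∈ Ideal.span ((fun s => monomial s (1 : K)) '' G) ↔ ∃ w ∈ G, w ≤ a := by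
  rw [mem_ideal_span_monomial_image]
  simp [support_monomial]

theorem span_hI {σ : Type} (G : Set (σ →₀ ℕ)) :
    ∀ p ∈ Ideal.span ((fun s => monomial s (1 : K)) '' G), ∀ a, coeff a p ≠ 0 →
      monomial a (1 : K) ∈ Ideal.span ((fun s => monomial s (1 : K)) '' G) := by
  intro p hp a ha
  rw [mono_mem]
  rw [mem_ideal_span_monomial_image] at hp
  exact hp a (mem_support_iff.2 ha)

theorem mem_colonOf (J : Ideal (Pp d m K)) (A : Finset (Var d m)) (p : Pp d m K) :
    p ∈ colonOf K J A ↔ p * monomial (sd A) 1 ∈ J := by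
  rw [colonOf]
  exact Submodule.mem_colon_span_singleton

theorem sd_last (u : Mon d m) (t : Fin d) :
    (Finsupp.mapDomain emb u : Vtx d m →₀ ℕ) ⟨t, Fin.last (m t)⟩ = 0 := by
  refine Finsupp.mapDomain_of_notMem_range _ _ ?_
  rintro ⟨v, hv⟩
  exact emb_ne_last' v t hv

theorem GE_last {S : Set (Mon d m)} {w : Vtx d m →₀ ℕ} (hw : w ∈ GE S) (t : Fin d) :
    w ⟨t, Fin.last (m t)⟩ = 0 := by
  rcases hw with ⟨u, _, rfl⟩ | ⟨i, j, k, _, rfl⟩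
  · exact sd_last u t
  · simp only [xd, Finsupp.add_apply]
    rw [Finsupp.single_eq_of_ne' (emb_ne_last' _ t), Finsupp.single_eq_of_ne' (emb_ne_last' _ t), add_zero]

theorem csf_card {A : Finset (Var d m)} (h : CSFSet A) : A.card ≤ d := by
  have := Finset.card_le_card_of_injOn (s := A) (t := (Finset.univ : Finset (Fin d)))
    (fun v => v.1) (fun _ _ => by simp) (fun v hv w hw hvw => h v hv w hw hvw)
  simpa using this

theorem final (I : Ideal (PR d m K))
    (hcsf : ∃ S : Set (Mon d m), (∀ u ∈ S, ColorSquarefree u) ∧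
      I = Ideal.span (mon K '' S))
    (β : ℕ → (Vtx d m →₀ ℕ) → ℕ)
    (βu : Finset (Var d m) → ℕ → (Vtx d m →₀ ℕ) → ℕ)
    (hβ : IsMinFreeRes (Vtx d m) K (id : (Vtx d m →₀ ℕ) → (Vtx d m →₀ ℕ))
      (extBr K I ⊔ lastIdeal K) β)
    (hβu : ∀ A : Finset (Var d m), CSFSet A →
      IsMinFreeRes (Vtx d m) K (id : (Vtx d m →₀ ℕ) → (Vtx d m →₀ ℕ))
        (colonOf K (extBr K I) A) (βu A)) :
    ∀ (k : ℕ) (a : Vtx d m →₀ ℕ),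
      β k a = ∑ j ∈ Finset.range (d + 1),
        ∑ A ∈ Finset.univ.filter (fun A : Finset (Var d m) => CSFSet A ∧ A.card = j),
          if j ≤ k ∧ shiftDeg A ≤ a then βu A (k - j) (a - shiftDeg A) else 0 := by
  obtain ⟨S, -, rfl⟩ := hcsf
  rw [extBr_eq, lastIdeal_eq, ← Ideal.span_union, ← Set.image_union] at hβ
  rw [extBr_eq] at hβu
  have hb := hasB_of_res _ (span_hI K _) _ hβ
  let E : (Vtx d m →₀ ℕ) → Prop := fun a => ∃ w ∈ GE S, w ≤ a
  have hE : ∀ a b, a ≤ b → E a → E b := fun a b hab ⟨w, hw, h⟩ => ⟨w, hw, h.trans hab⟩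
  have hy : ∀ a (v : Var d m), E (a + yd v) → E a := by
    rintro a v ⟨w, hw, h⟩
    refine ⟨w, hw, fun t => ?_⟩
    by_cases ht : (⟨v.1, Fin.last (m v.1)⟩ : Vtx d m) = t
    · rw [← ht, GE_last hw]; exact Nat.zero_le _
    · have := h t
      rwa [Finsupp.add_apply, yd, Finsupp.single_eq_of_ne' ht, add_zero] at this
  have hbr : ∀ v w : Var d m, v ≠ w → v.1 = w.1 → E (xd v + xd w) := by
    rintro ⟨i, j⟩ ⟨i', k⟩ hne (rfl : i = i')
    rcases lt_trichotomy j k with h | h | h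
    · exact ⟨_, Or.inr ⟨i, j, k, h, rfl⟩, le_rfl⟩
    · exact absurd (by rw [h]) hne
    · refine ⟨_, Or.inr ⟨i, k, j, h, rfl⟩, ?_⟩
      rw [add_comm]
  have h0 : ∀ B, CSFSet B → HasB K (fun a => ¬ E (a + sd B)) (βu B) := by
    intro B hB
    have := hasB_of_res _ (fun p hp a ha => ?_) _ (hβu B hB)
    · convert this using 2 with a
      rw [mem_colonOf, monomial_mul, one_mul, mono_mem]
    · rw [mem_colonOf] at hp ⊢
      rw [monomial_mul, one_mul]
      refine span_hI K _ _ hp _ ?_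
      rw [coeff_mul_monomial, mul_one]
      exact ha
  have hmain := main_ind K hE hy hbr βu h0 _ Finset.univ ∅ le_rfl
    (by intro v hv; simp at hv) (by intro v _ w hw; simp at hw)
  have hQ : (fun a => ¬ Dead E Finset.univ ∅ a) = fun a => monomial a (1 : K) ∉
      Ideal.span ((fun s => monomial s (1 : K)) '' (GE S ∪ GLast)) := by
    funext a
    rw [mono_mem]
    simp only [Dead, sd, Finset.sum_empty, add_zero, Finset.mem_univ, true_and, E, eq_iff_iff]
    refine not_congr ?_
    constructor
    · rintro (⟨w, hw, h⟩ | ⟨v, h⟩)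
      · exact ⟨w, Or.inl hw, h⟩
      · exact ⟨_, Or.inr ⟨v, rfl⟩, h⟩
    · rintro ⟨w, hw | ⟨v, rfl⟩, h⟩
      · exact Or.inl ⟨w, hw, h⟩
      · exact Or.inr ⟨v, h⟩
  rw [hQ] at hmain
  intro k a
  rw [HasB.unique hb hmain k a, bt, Finset.powerset_univ,
    ← Finset.sum_fiberwise_of_maps_to (s := Finset.univ.filter CSFSet)
      (t := Finset.range (d + 1)) (g := fun A => A.card)]
  · refine Finset.sum_congr rfl fun j _ => ?_
    rw [Finset.filter_filter]
    refine Finset.sum_congr rfl fun A hA => ?_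
    rw [(Finset.mem_filter.1 hA).2.2, Finset.union_empty]
  · intro A hA
    exact Finset.mem_range.2 (Nat.lt_succ_of_le (csf_card (Finset.mem_filter.1 hA).2))

end Fin1

end Aux

/-- Theorem `thm:add polarized squares` (c).  Let `I ⊆ P(d,m)` be a
color-squarefree monomial ideal and `I' = I + 𝔪_1^{[2]} + ⋯ + 𝔪_d^{[2]} ⊆ P'`.  The
`ℤ^{d+|m|}`-graded Betti numbers of `P'/(I' + Σ_i x_{i,m_i+1}·𝔪_i)` are
`β_{k,a} = Σ_{j=0}^d Σ_{u ∈ [Mon_cs(P)]_j} β_{k-j, a - deg(u·∏_{i∈cSupp u} x_{i,m_i+1})}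
(P'/(I' : u))`. -/
theorem statement_18 {d : ℕ} {m : Fin d → ℕ} (K : Type*) [Field K]
    (I : Ideal (PR d m K))
    (hcsf : ∃ S : Set (Mon d m), (∀ u ∈ S, ColorSquarefree u) ∧
      I = Ideal.span (mon K '' S))
    (β : ℕ → (Vtx d m →₀ ℕ) → ℕ)
    (βu : Finset (Var d m) → ℕ → (Vtx d m →₀ ℕ) → ℕ)
    (hβ : IsMinFreeRes (Vtx d m) K (id : (Vtx d m →₀ ℕ) → (Vtx d m →₀ ℕ))
      (extBr K I ⊔ lastIdeal K) β)
    (hβu : ∀ A : Finset (Var d m), CSFSet A →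
      IsMinFreeRes (Vtx d m) K (id : (Vtx d m →₀ ℕ) → (Vtx d m →₀ ℕ))
        (colonOf K (extBr K I) A) (βu A)) :
    ∀ (k : ℕ) (a : Vtx d m →₀ ℕ),
      β k a = ∑ j ∈ Finset.range (d + 1),
        ∑ A ∈ Finset.univ.filter (fun A : Finset (Var d m) => CSFSet A ∧ A.card = j),
          if j ≤ k ∧ shiftDeg A ≤ a then βu A (k - j) (a - shiftDeg A) else 0 := by
  exact final K I hcsf β βu hβ hβu

end BalSq
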